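/- arXiv:2009.10016 — 2 statements merged into one kernel-verified Lean document; each statement's English description precedes it below -/
import Mathlib

section
/- Let 0 < α < 1 and let φ_α be the Wright type function φ_α(z) = Σ_{k=0}^∞ (−z)^k/(k! Γ(−αk + 1 − α)). Then for every real r > −1, ∫_0^{+∞} φ_α(θ) θ^{r} dθ = Γ(1 + r) / Γ(1 + αr). -/
noncomputable section

/-- Wright type function `φ_α(z) = Σ_{k} (−z)^k/(k! Γ(−αk + 1 − α))`. -/
def wrightFn (α z : ℝ) : ℝ :=
  ∑' k : ℕ, (-z) ^ k / ((k.factorial : ℝ) * Real.Gamma (-α * (k : ℝ) + 1 - α))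

open MeasureTheory Set Filter Topology Complex

lemma integrableOn_rpow_mul_exp_neg_mul {p b : ℝ} (hp : -1 < p) (hb : 0 < b) :
    IntegrableOn (fun t : ℝ ↦ t ^ p * Real.exp (-(b * t))) (Ioi 0) := by
  simpa using integrableOn_rpow_mul_exp_neg_mul_rpow hp one_pos hb

lemma norm_rpow_mul_cexp_neg_mul {t : ℝ} (ht : 0 < t) (p : ℝ) (w : ℂ) :
    ‖((t ^ p : ℝ) : ℂ) * cexp (-(w * t))‖ = t ^ p * Real.exp (-(w.re * t)) := by
  rw [norm_mul, norm_exp, norm_real, Real.norm_of_nonneg (Real.rpow_nonneg ht.le _)]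
  simp

lemma integrableOn_rpow_mul_cexp_neg_mul {p : ℝ} (hp : -1 < p) {w : ℂ} (hw : 0 < w.re) :
    IntegrableOn (fun t : ℝ ↦ ((t ^ p : ℝ) : ℂ) * cexp (-(w * t))) (Ioi 0) := by
  refine (integrableOn_rpow_mul_exp_neg_mul hp hw).mono' (by fun_prop) ?_
  filter_upwards [ae_restrict_mem measurableSet_Ioi] with t ht
  rw [norm_rpow_mul_cexp_neg_mul ht]

/-- Euler's integral for the Gamma function, along a rotated ray. -/
lemma integral_rpow_mul_cexp_neg_mul {a : ℝ} (ha : 0 < a) {w : ℂ} (hw : 0 < w.re) :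
    ∫ t in Ioi (0 : ℝ), ((t ^ (a - 1) : ℝ) : ℂ) * cexp (-(w * t)) =
      Real.Gamma a * w ^ (-a : ℂ) := by
  have hopen : IsOpen {z : ℂ | 0 < z.re} := isOpen_lt continuous_const continuous_re
  have hleft : DifferentiableOn ℂ
      (fun z : ℂ ↦ ∫ t in Ioi (0 : ℝ), ((t ^ (a - 1) : ℝ) : ℂ) * cexp (-(z * t)))
      {z : ℂ | 0 < z.re} := by
    intro z hz
    have hz : 0 < z.re := hz
    refine (hasDerivAt_integral_of_dominated_loc_of_deriv_le
      (F := fun (z : ℂ) (t : ℝ) ↦ ((t ^ (a - 1) : ℝ) : ℂ) * cexp (-(z * t)))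
      (F' := fun (z : ℂ) (t : ℝ) ↦ ((t ^ (a - 1) : ℝ) : ℂ) * (cexp (-(z * t)) * (-t)))
      (bound := fun t ↦ t ^ a * Real.exp (-(z.re / 2 * t)))
      (s := {y : ℂ | z.re / 2 < y.re})
      ((isOpen_lt continuous_const continuous_re).mem_nhds (by simpa using hz))
      (.of_forall fun _ ↦ by fun_prop)
      (integrableOn_rpow_mul_cexp_neg_mul (by linarith) hz) (by fun_prop) ?_
      (integrableOn_rpow_mul_exp_neg_mul (by linarith) (by linarith))
      ?_).2.differentiableAt.differentiableWithinAt
    · filter_upwards [ae_restrict_mem measurableSet_Ioi] with t ht y hy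
      have ht : 0 < t := ht
      have hy : z.re / 2 < y.re := hy
      rw [← mul_assoc, norm_mul, norm_rpow_mul_cexp_neg_mul ht, norm_neg, norm_real,
        Real.norm_of_nonneg ht.le, mul_right_comm]
      nth_rewrite 2 [← Real.rpow_one t]
      rw [← Real.rpow_add ht, sub_add_cancel]
      gcongr
    · refine .of_forall fun t y _ ↦ ?_
      have := ((((hasDerivAt_id y).mul_const (t : ℂ)).neg).cexp).const_mul
        (((t ^ (a - 1) : ℝ) : ℂ))
      simpa using this
  have hright : DifferentiableOn ℂ (fun z : ℂ ↦ Real.Gamma a * z ^ (-a : ℂ))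
      {z : ℂ | 0 < z.re} := fun z hz ↦
    ((differentiableAt_id.cpow_const (.inl hz)).const_mul _).differentiableWithinAt
  refine (hleft.analyticOnNhd hopen).eqOn_of_preconnected_of_frequently_eq
    (hright.analyticOnNhd hopen) (convex_halfSpace_re_gt 0).isPreconnected
    (z₀ := 1) (by simp) ?_ hw
  have htend : Tendsto (fun x : ℝ ↦ (x : ℂ)) (𝓝[≠] 1) (𝓝[≠] 1) := by
    refine tendsto_nhdsWithin_iff.2 ⟨?_, ?_⟩
    · exact (continuous_ofReal.tendsto' 1 1 (by simp)).mono_left nhdsWithin_le_nhds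
    · filter_upwards [self_mem_nhdsWithin] with x hx
      simpa using hx
  refine htend.frequently (Eventually.frequently ?_)
  filter_upwards [nhdsWithin_le_nhds (lt_mem_nhds (zero_lt_one' ℝ))] with x hx
  have := Real.integral_rpow_mul_exp_neg_mul_Ioi ha hx
  rw [one_div, Real.inv_rpow hx.le, ← Real.rpow_neg hx.le, mul_comm] at this
  rw [← ofReal_neg, ← ofReal_cpow hx.le, ← ofReal_mul, ← this, ← integral_complex_ofReal]
  push_cast
  rfl

lemma rpow_le_rpow_add_rpow {m x M : ℝ} (hm : 0 < m) (hmx : m ≤ x) (hxM : x ≤ M) (p : ℝ) :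
    x ^ p ≤ m ^ p + M ^ p := by
  have hx : 0 < x := hm.trans_le hmx
  rcases le_total 0 p with hp | hp
  · exact (Real.rpow_le_rpow hx.le hxM hp).trans
      (le_add_of_nonneg_left (Real.rpow_nonneg hm.le _))
  · exact (Real.rpow_le_rpow_of_nonpos hm hmx hp).trans
      (le_add_of_nonneg_right (Real.rpow_nonneg (hx.le.trans hxM) _))

lemma integrableOn_exp_neg_mul_rpow_mul_exp {c A α : ℝ} (hc : 0 < c) (hA : 0 < A) (hα : α < 1)
    (p θ : ℝ) :
    IntegrableOn (fun t : ℝ ↦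
      Real.exp (-(c * t)) * ((A + t) ^ p * Real.exp (θ * (A + t) ^ α))) (Ioi 0) := by
  refine integrable_of_isBigO_exp_neg (b := c / 2) (by positivity) ?_ ?_
  · have hne : ∀ t ∈ Ici (0 : ℝ), A + t ≠ 0 := fun t ht ↦
      (add_pos_of_pos_of_nonneg hA ht).ne'
    have h (q : ℝ) : ContinuousOn (fun t : ℝ ↦ (A + t) ^ q) (Ici 0) :=
      ContinuousOn.rpow_const (by fun_prop) fun t ht ↦ .inl (hne t ht)
    exact ContinuousOn.mul (by fun_prop)
      ((h p).mul (((h α).const_mul θ).rexp))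
  · have hshift : Tendsto (fun t : ℝ ↦ A + t) atTop atTop :=
      tendsto_atTop_add_const_left _ _ tendsto_id
    have hpow : (fun t : ℝ ↦ (A + t) ^ p) =O[atTop] fun t ↦ Real.exp (c / 4 * (A + t)) :=
      ((isLittleO_rpow_exp_pos_mul_atTop p (by positivity)).comp_tendsto hshift).isBigO
    have hexp : (fun t : ℝ ↦ Real.exp (θ * (A + t) ^ α)) =O[atTop]
        fun t ↦ Real.exp (c / 4 * (A + t)) := by
      have hlit : (fun x : ℝ ↦ θ * x ^ α) =o[atTop] fun x : ℝ ↦ x := by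
        refine Asymptotics.IsLittleO.const_mul_left ?_ θ
        refine Asymptotics.isLittleO_of_tendsto' ?_ ?_
        · filter_upwards [eventually_gt_atTop 0] with x hx h
          exact absurd h hx.ne'
        · refine (tendsto_rpow_neg_atTop (sub_pos.2 hα)).congr' ?_
          filter_upwards [eventually_gt_atTop 0] with x hx
          rw [neg_sub, Real.rpow_sub_one hx.ne']
      have hev := (hlit.comp_tendsto hshift).def (show 0 < c / 4 by positivity)
      refine Asymptotics.IsBigO.of_bound 1 ?_
      filter_upwards [hev, hshift.eventually_ge_atTop 0] with t ht h0
      simp only [Function.comp_apply, Real.norm_of_nonneg h0] at ht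
      rw [Real.norm_of_nonneg (Real.exp_nonneg _), Real.norm_of_nonneg (Real.exp_nonneg _),
        one_mul]
      exact Real.exp_le_exp.2 ((Real.le_norm_self _).trans ht)
    have := (Asymptotics.isBigO_refl (fun t : ℝ ↦ Real.exp (-(c * t))) atTop).mul
      (hpow.mul hexp)
    refine this.trans (Asymptotics.IsBigO.of_bound (Real.exp (c / 2 * A)) (.of_forall fun t ↦ ?_))
    simp only [← Real.exp_add, Real.norm_of_nonneg (Real.exp_nonneg _)]
    exact Real.exp_le_exp.2 (by linarith)

lemma integrableOn_exp_neg_mul_add_rpow {c A : ℝ} (hc : 0 < c) (hA : 0 < A) (p : ℝ) :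
    IntegrableOn (fun t : ℝ ↦ Real.exp (-(c * t)) * (A + t) ^ p) (Ioi 0) := by
  simpa using integrableOn_exp_neg_mul_rpow_mul_exp hc hA zero_lt_one p 0

/-- The ray issuing from the real number `a` in the direction `exp (i ψ)`. -/
def complexRay (ψ a t : ℝ) : ℂ := a + t * cexp (ψ * I)

lemma complexRay_re (ψ a t : ℝ) : (complexRay ψ a t).re = a + t * Real.cos ψ := by
  simp [complexRay, exp_ofReal_mul_I_re]

lemma complexRay_im (ψ a t : ℝ) : (complexRay ψ a t).im = t * Real.sin ψ := by
  simp [complexRay, exp_ofReal_mul_I_im]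

lemma measurable_complexRay (ψ a : ℝ) : Measurable (complexRay ψ a) := by
  unfold complexRay
  fun_prop

lemma sq_norm_complexRay (ψ a t : ℝ) :
    ‖complexRay ψ a t‖ ^ 2 = (a + t * Real.cos ψ) ^ 2 + (t * Real.sin ψ) ^ 2 := by
  rw [Complex.sq_norm, normSq_apply, complexRay_re, complexRay_im]
  ring

lemma norm_complexRay_le {ψ a t : ℝ} (ha : 0 ≤ a) (ht : 0 ≤ t) : ‖complexRay ψ a t‖ ≤ a + t := by
  refine (norm_add_le _ _).trans_eq ?_
  rw [norm_mul, norm_exp_ofReal_mul_I, norm_real, norm_real, Real.norm_of_nonneg ha,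
    Real.norm_of_nonneg ht, mul_one]

lemma sub_le_norm_complexRay {ψ a t : ℝ} (ha : 0 ≤ a) (ht : 0 ≤ t) :
    t - a ≤ ‖complexRay ψ a t‖ := by
  have := norm_sub_le (complexRay ψ a t) a
  rw [complexRay, add_sub_cancel_left, norm_mul, norm_exp_ofReal_mul_I, norm_real, norm_real,
    Real.norm_of_nonneg ha, Real.norm_of_nonneg ht, mul_one] at this
  rw [complexRay]
  linarith

lemma mul_sin_le_norm_complexRay (ψ a t : ℝ) : a * Real.sin ψ ≤ ‖complexRay ψ a t‖ := by
  refine le_of_abs_le (abs_le_of_sq_le_sq ?_ (norm_nonneg _))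
  rw [sq_norm_complexRay, mul_pow t, mul_pow a, Real.sin_sq]
  nlinarith [sq_nonneg (a * Real.cos ψ + t)]

lemma sin_mul_le_norm_complexRay (ψ a t : ℝ) : t * Real.sin ψ ≤ ‖complexRay ψ a t‖ := by
  rw [← complexRay_im ψ a t]
  exact (le_abs_self _).trans (abs_im_le_norm _)

lemma complexRay_mem_slitPlane {ψ a t : ℝ} (hψ : 0 < Real.sin ψ) (ha : 0 < a) (ht : 0 ≤ t) :
    complexRay ψ a t ∈ slitPlane := by
  rcases ht.eq_or_lt with rfl | ht
  · simp [complexRay, ha]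
  · exact .inr (by rw [complexRay_im]; positivity)

lemma arg_complexRay_mem_Icc {ψ a t : ℝ} (hψ : Real.pi / 2 < ψ) (hψ' : ψ < Real.pi) (ha : 0 < a)
    (ht : 0 ≤ t) : (complexRay ψ a t).arg ∈ Icc 0 ψ := by
  have hsin : 0 < Real.sin ψ := Real.sin_pos_of_pos_of_lt_pi (by linarith [Real.pi_pos]) hψ'
  have hcos : Real.cos ψ < 0 := Real.cos_neg_of_pi_div_two_lt_of_lt hψ (by linarith)
  have hne : complexRay ψ a t ≠ 0 := slitPlane_ne_zero (complexRay_mem_slitPlane hsin ha ht)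
  have h0 : 0 ≤ (complexRay ψ a t).arg := by
    rw [arg_nonneg_iff, complexRay_im]
    positivity
  refine ⟨h0, ?_⟩
  by_contra! hlt
  have := Real.cos_lt_cos_of_nonneg_of_le_pi (by linarith [Real.pi_pos]) (arg_le_pi _) hlt
  rw [cos_arg hne, div_lt_iff₀ (norm_pos_iff.2 hne), complexRay_re] at this
  nlinarith [sub_le_norm_complexRay (ψ := ψ) ha.le ht, Real.neg_one_le_cos ψ]

lemma norm_cexp_mul_cpow_complexRay (ψ a t p : ℝ) :
    ‖cexp (complexRay ψ a t) * complexRay ψ a t ^ (p : ℂ)‖ =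
      Real.exp (a + t * Real.cos ψ) * ‖complexRay ψ a t‖ ^ p := by
  rw [norm_mul, norm_exp, norm_cpow_real, complexRay_re]

/-- A bound which is uniform for the starting point of the ray in a compact interval. -/
lemma norm_cexp_mul_cpow_complexRay_le {ψ a b B t : ℝ} (hψ : 0 < Real.sin ψ) (hb : 0 < b)
    (hba : b ≤ a) (haB : a ≤ B) (ht : 0 ≤ t) (p : ℝ) :
    ‖cexp (complexRay ψ a t) * complexRay ψ a t ^ (p : ℂ)‖ ≤
      Real.exp B * (Real.exp (-(-Real.cos ψ * t)) *
        ((b * Real.sin ψ) ^ p + (B + t) ^ p)) := by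
  have ha : 0 < a := hb.trans_le hba
  rw [norm_cexp_mul_cpow_complexRay, ← mul_assoc, ← Real.exp_add]
  gcongr
  · linarith
  · refine rpow_le_rpow_add_rpow (by positivity) ?_ ?_ p
    · exact le_trans (by gcongr) (mul_sin_le_norm_complexRay ψ a t)
    · exact (norm_complexRay_le ha.le ht).trans (by gcongr)

lemma integrableOn_cexp_mul_cpow_complexRay_bound {ψ B : ℝ} (hψ : Real.cos ψ < 0) (hB : 0 < B)
    (K p : ℝ) :
    IntegrableOn (fun t : ℝ ↦ Real.exp B * (Real.exp (-(-Real.cos ψ * t)) *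
        (K + (B + t) ^ p))) (Ioi 0) := by
  refine Integrable.const_mul ?_ _
  simp only [mul_add]
  refine Integrable.add ?_ (integrableOn_exp_neg_mul_add_rpow (by linarith) hB p)
  refine Integrable.mul_const ?_ _
  simpa [IntegrableOn] using
    integrableOn_exp_neg_mul_add_rpow (c := -Real.cos ψ) (by linarith) hB 0

lemma aestronglyMeasurable_cexp_mul_cpow_complexRay (ψ a p : ℝ) (μ : Measure ℝ) :
    AEStronglyMeasurable (fun t : ℝ ↦ cexp (complexRay ψ a t) * complexRay ψ a t ^ (p : ℂ)) μ := by
  have := measurable_complexRay ψ a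
  exact Measurable.aestronglyMeasurable (by fun_prop)

lemma integrableOn_cexp_mul_cpow_complexRay {ψ a : ℝ} (hψ : 0 < Real.sin ψ)
    (hψ' : Real.cos ψ < 0) (ha : 0 < a) (p : ℝ) :
    IntegrableOn (fun t : ℝ ↦ cexp (complexRay ψ a t) * complexRay ψ a t ^ (p : ℂ)) (Ioi 0) := by
  refine (integrableOn_cexp_mul_cpow_complexRay_bound hψ' ha ((a * Real.sin ψ) ^ p) p).mono'
    (aestronglyMeasurable_cexp_mul_cpow_complexRay ψ a p _) ?_
  filter_upwards [ae_restrict_mem measurableSet_Ioi] with t ht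
  exact norm_cexp_mul_cpow_complexRay_le hψ ha le_rfl le_rfl (le_of_lt ht) p

lemma hasDerivAt_cexp_mul_cpow {z : ℂ} (hz : z ∈ slitPlane) (p : ℝ) :
    HasDerivAt (fun z : ℂ ↦ cexp z * z ^ (p : ℂ))
      (cexp z * z ^ (p : ℂ) + p * (cexp z * z ^ ((p - 1 : ℝ) : ℂ))) z := by
  convert! (Complex.hasDerivAt_exp z).mul ((hasDerivAt_id z).cpow_const (c := (p : ℂ)) hz) using 1
  push_cast
  simp
  ring

/-- The integral of `exp z * z ^ p` along the ray from `a` in the direction `exp (i ψ)`. -/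
def hankelRayIntegral (ψ a p : ℝ) : ℂ :=
  cexp (ψ * I) * ∫ t in Ioi (0 : ℝ), cexp (complexRay ψ a t) * complexRay ψ a t ^ (p : ℂ)

lemma hankelRayIntegral_add_mul_eq {ψ a : ℝ} (hψ : 0 < Real.sin ψ) (hψ' : Real.cos ψ < 0)
    (ha : 0 < a) (p : ℝ) :
    hankelRayIntegral ψ a p + p * hankelRayIntegral ψ a (p - 1) =
      -((Real.exp a * a ^ p : ℝ) : ℂ) := by
  have hint := integrableOn_cexp_mul_cpow_complexRay hψ hψ' ha
  have hderiv (t : ℝ) (ht : t ∈ Ici (0 : ℝ)) : HasDerivAt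
      (fun t : ℝ ↦ cexp (complexRay ψ a t) * complexRay ψ a t ^ (p : ℂ))
      ((cexp (complexRay ψ a t) * complexRay ψ a t ^ (p : ℂ) +
        p * (cexp (complexRay ψ a t) * complexRay ψ a t ^ ((p - 1 : ℝ) : ℂ))) *
          cexp (ψ * I)) t := by
    have hray : HasDerivAt (complexRay ψ a) (cexp (ψ * I)) t := by
      convert! ((hasDerivAt_id t).ofReal_comp.mul_const (cexp (ψ * I))).const_add (a : ℂ) using 1
      simp
    exact (hasDerivAt_cexp_mul_cpow (complexRay_mem_slitPlane hψ ha ht) p).comp t hray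
  have hint' : IntegrableOn (fun t : ℝ ↦
      (cexp (complexRay ψ a t) * complexRay ψ a t ^ (p : ℂ) +
        p * (cexp (complexRay ψ a t) * complexRay ψ a t ^ ((p - 1 : ℝ) : ℂ))) *
          cexp (ψ * I)) (Ioi 0) :=
    Integrable.mul_const ((hint p).add ((hint (p - 1)).const_mul _)) _
  have key := integral_Ioi_of_hasDerivAt_of_tendsto' hderiv hint'
    (tendsto_zero_of_hasDerivAt_of_integrableOn_Ioi (fun t ht ↦ hderiv t (Ioi_subset_Ici_self ht))
      hint' (hint p))
  rw [integral_mul_const, integral_add (hint p) ((hint (p - 1)).const_mul _),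
    integral_const_mul] at key
  simp only [complexRay, ofReal_zero, zero_mul, add_zero, zero_sub] at key
  rw [ofReal_mul, ofReal_exp, ofReal_cpow ha.le, ← key]
  simp only [hankelRayIntegral, complexRay]
  ring

lemma hasDerivAt_hankelRayIntegral {ψ a : ℝ} (hψ : 0 < Real.sin ψ) (hψ' : Real.cos ψ < 0)
    (ha : 0 < a) (p : ℝ) :
    HasDerivAt (fun a ↦ hankelRayIntegral ψ a p) (-((Real.exp a * a ^ p : ℝ) : ℂ)) a := by
  have hint := integrableOn_cexp_mul_cpow_complexRay hψ hψ' ha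
  have hmeas := fun (q : ℝ) (b : ℝ) ↦
    aestronglyMeasurable_cexp_mul_cpow_complexRay ψ b q (volume.restrict (Ioi 0))
  have hbound (q : ℝ) := integrableOn_cexp_mul_cpow_complexRay_bound (B := 2 * a) hψ'
    (by positivity) ((a / 2 * Real.sin ψ) ^ q) q
  have key := (hasDerivAt_integral_of_dominated_loc_of_deriv_le
    (F := fun (a t : ℝ) ↦ cexp (complexRay ψ a t) * complexRay ψ a t ^ (p : ℂ))
    (F' := fun (a t : ℝ) ↦ cexp (complexRay ψ a t) * complexRay ψ a t ^ (p : ℂ) +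
        p * (cexp (complexRay ψ a t) * complexRay ψ a t ^ ((p - 1 : ℝ) : ℂ)))
    (s := Ioo (a / 2) (2 * a)) (Ioo_mem_nhds (by linarith) (by linarith))
    (.of_forall fun b ↦ hmeas p b) (hint p) ((hmeas p a).add ((hmeas (p - 1) a).const_mul _))
    (by
      filter_upwards [ae_restrict_mem measurableSet_Ioi] with t ht b hb
      refine (norm_add_le _ _).trans (add_le_add
        (norm_cexp_mul_cpow_complexRay_le hψ (half_pos ha) hb.1.le hb.2.le (le_of_lt ht) p) ?_)
      rw [norm_mul, norm_real]
      exact mul_le_mul_of_nonneg_left (norm_cexp_mul_cpow_complexRay_le hψ (half_pos ha)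
        hb.1.le hb.2.le (le_of_lt ht) (p - 1)) (norm_nonneg _))
    ((hbound p).add ((hbound (p - 1)).const_mul _))
    (by
      filter_upwards [ae_restrict_mem measurableSet_Ioi] with t ht b hb
      have hray : HasDerivAt (fun b ↦ complexRay ψ b t) 1 b := by
        simpa [complexRay] using (hasDerivAt_id b).ofReal_comp.add_const (t * cexp (ψ * I))
      have := (hasDerivAt_cexp_mul_cpow (complexRay_mem_slitPlane hψ
        ((half_pos ha).trans hb.1) (le_of_lt ht)) p).comp b hray
      rw [mul_one] at this
      exact this)).2
  rw [← hankelRayIntegral_add_mul_eq hψ hψ' ha p]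
  convert! key.const_mul (cexp (ψ * I)) using 1
  rw [integral_add (hint p) ((hint (p - 1)).const_mul _), integral_const_mul]
  simp only [hankelRayIntegral]
  ring

lemma im_hankelRayIntegral_eq {ψ a b : ℝ} (hψ : 0 < Real.sin ψ) (hψ' : Real.cos ψ < 0)
    (ha : 0 < a) (hb : 0 < b) (p : ℝ) :
    (hankelRayIntegral ψ a p).im = (hankelRayIntegral ψ b p).im := by
  have hder (x : ℝ) (hx : 0 < x) :
      HasDerivAt (fun a ↦ (hankelRayIntegral ψ a p).im) 0 x := by
    have := imCLM.hasFDerivAt.comp_hasDerivAt x (hasDerivAt_hankelRayIntegral hψ hψ' hx p)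
    rw [imCLM_apply, neg_im, ofReal_im, neg_zero] at this
    exact this
  obtain ⟨c, hc⟩ := isOpen_Ioi.exists_is_const_of_deriv_eq_zero (s := Ioi (0 : ℝ))
    isPreconnected_Ioi (fun x hx ↦ (hder x hx).differentiableAt.differentiableWithinAt)
    (fun x hx ↦ (hder x hx).deriv)
  rw [hc a ha, hc b hb]

lemma tendsto_hankelRayIntegral_zero {ψ p : ℝ} (hψ : 0 < Real.sin ψ) (hψ' : Real.cos ψ < 0)
    (hp : -1 < p) (hp' : p ≤ 0) :
    Tendsto (fun a ↦ hankelRayIntegral ψ a p) (𝓝[>] 0) (𝓝 (hankelRayIntegral ψ 0 p)) := by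
  refine Tendsto.const_mul _ (tendsto_integral_filter_of_dominated_convergence
    (fun t ↦ Real.exp 1 * Real.sin ψ ^ p * (t ^ p * Real.exp (-(-Real.cos ψ * t))))
    (.of_forall fun a ↦ aestronglyMeasurable_cexp_mul_cpow_complexRay ψ a p _) ?_
    ((integrableOn_rpow_mul_exp_neg_mul hp (by linarith)).const_mul _) ?_)
  · filter_upwards [Ioo_mem_nhdsGT (zero_lt_one' ℝ)] with a ha
    filter_upwards [ae_restrict_mem measurableSet_Ioi] with t ht
    have ht : 0 < t := ht
    rw [norm_cexp_mul_cpow_complexRay]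
    have h1 : ‖complexRay ψ a t‖ ^ p ≤ t ^ p * Real.sin ψ ^ p := by
      rw [← Real.mul_rpow ht.le hψ.le]
      exact Real.rpow_le_rpow_of_nonpos (by positivity) (sin_mul_le_norm_complexRay ψ a t) hp'
    have h2 : Real.exp (a + t * Real.cos ψ) ≤ Real.exp 1 * Real.exp (-(-Real.cos ψ * t)) := by
      rw [← Real.exp_add]
      exact Real.exp_le_exp.2 (by linarith [ha.2])
    calc _ ≤ (Real.exp 1 * Real.exp (-(-Real.cos ψ * t))) * (t ^ p * Real.sin ψ ^ p) := by gcongr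
      _ = _ := by ring
  · filter_upwards [ae_restrict_mem measurableSet_Ioi] with t ht
    have ht : 0 < t := ht
    have hmem : complexRay ψ 0 t ∈ slitPlane := .inr (by rw [complexRay_im]; positivity)
    have hray : Continuous (fun a ↦ complexRay ψ a t) := by
      unfold complexRay
      fun_prop
    exact ((hasDerivAt_cexp_mul_cpow hmem p).continuousAt.comp_of_eq
      hray.continuousAt rfl).tendsto.mono_left nhdsWithin_le_nhds

lemma hankelRayIntegral_zero_left {ψ p : ℝ} (hψ : Real.pi / 2 < ψ) (hψ' : ψ < Real.pi)
    (hp : -1 < p) :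
    hankelRayIntegral ψ 0 p =
      Real.Gamma (1 + p) * cexp ((Real.pi * (1 + p) : ℝ) * I) := by
  have hpi := Real.pi_pos
  have hcos : Real.cos ψ < 0 := Real.cos_neg_of_pi_div_two_lt_of_lt hψ (by linarith)
  have hneg : -cexp (ψ * I) = cexp ((ψ - Real.pi : ℝ) * I) := by
    rw [ofReal_sub, sub_mul, Complex.exp_sub, exp_pi_mul_I, div_neg, div_one]
  have hcongr : ∫ t in Ioi (0 : ℝ), cexp (complexRay ψ 0 t) * complexRay ψ 0 t ^ (p : ℂ) =
      ∫ t in Ioi (0 : ℝ), cexp ((ψ * p : ℝ) * I) *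
        (((t ^ ((1 + p) - 1) : ℝ) : ℂ) * cexp (-(-cexp (ψ * I) * t))) := by
    refine setIntegral_congr_fun measurableSet_Ioi fun t ht ↦ ?_
    have ht : 0 < t := ht
    have hlog : log (cexp (ψ * I)) = ψ * I := by
      rw [log_exp] <;> simp <;> linarith
    have hpow : ((t : ℂ) * cexp (ψ * I)) ^ (p : ℂ) =
        ((t ^ p : ℝ) : ℂ) * cexp ((ψ * p : ℝ) * I) := by
      rw [cpow_def_of_ne_zero (by simp [ht.ne', Complex.exp_ne_zero]),
        log_ofReal_mul ht (Complex.exp_ne_zero _), hlog, Real.rpow_def_of_pos ht, ofReal_exp,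
        ← Complex.exp_add]
      push_cast
      ring_nf
    simp only [complexRay, ofReal_zero, zero_add, add_sub_cancel_left]
    rw [hpow]
    ring_nf
  have hre : 0 < (-cexp (ψ * I)).re := by
    rw [neg_re, exp_ofReal_mul_I_re]
    linarith
  rw [hankelRayIntegral, hcongr, integral_const_mul,
    integral_rpow_mul_cexp_neg_mul (by linarith) hre, hneg, cpow_def_of_ne_zero
    (Complex.exp_ne_zero _), log_exp (by simp; linarith) (by simp; linarith), mul_left_comm,
    mul_left_comm (cexp (ψ * I)), mul_left_comm, ← Complex.exp_add, ← Complex.exp_add]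
  push_cast
  ring_nf

lemma im_hankelRayIntegral_of_mem_Ioo {ψ p : ℝ} (hψ : Real.pi / 2 < ψ) (hψ' : ψ < Real.pi)
    (hp : p ∈ Ioo (-1) 0) :
    (hankelRayIntegral ψ 1 p).im = Real.pi * (Real.Gamma (-p))⁻¹ := by
  have hpi := Real.pi_pos
  have hsin : 0 < Real.sin ψ := Real.sin_pos_of_pos_of_lt_pi (by linarith) hψ'
  have hcos : Real.cos ψ < 0 := Real.cos_neg_of_pi_div_two_lt_of_lt hψ (by linarith)
  have hlim := (continuous_im.tendsto _).comp
    (tendsto_hankelRayIntegral_zero hsin hcos hp.1 hp.2.le)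
  have hconst : Tendsto (fun a ↦ (hankelRayIntegral ψ a p).im) (𝓝[>] 0)
      (𝓝 (hankelRayIntegral ψ 1 p).im) := by
    refine tendsto_const_nhds.congr' ?_
    filter_upwards [self_mem_nhdsWithin] with a ha
    exact im_hankelRayIntegral_eq hsin hcos one_pos ha p
  rw [tendsto_nhds_unique hconst hlim, hankelRayIntegral_zero_left hψ hψ' hp.1, im_ofReal_mul,
    exp_ofReal_mul_I_im]
  have hrefl := Real.Gamma_mul_Gamma_one_sub (-p)
  have hs : Real.sin (Real.pi * (1 + p)) = Real.sin (Real.pi * -p) := by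
    rw [← Real.sin_pi_sub]
    ring_nf
  have hpos : 0 < Real.sin (Real.pi * -p) :=
    Real.sin_pos_of_pos_of_lt_pi (by nlinarith [hp.2]) (by nlinarith [hp.1])
  have hG : Real.Gamma (-p) ≠ 0 := (Real.Gamma_pos_of_pos (by linarith [hp.2])).ne'
  rw [sub_neg_eq_add] at hrefl
  rw [hs, ← div_eq_mul_inv, eq_div_iff hG, mul_right_comm, mul_comm (Real.Gamma (1 + p)), hrefl,
    div_mul_cancel₀ _ hpos.ne']

lemma im_hankelRayIntegral_sub_one {ψ : ℝ} (hψ : 0 < Real.sin ψ) (hψ' : Real.cos ψ < 0) (p : ℝ) :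
    (hankelRayIntegral ψ 1 p).im = -p * (hankelRayIntegral ψ 1 (p - 1)).im := by
  have := congrArg Complex.im (hankelRayIntegral_add_mul_eq hψ hψ' one_pos p)
  rw [add_im, im_ofReal_mul, neg_im, ofReal_im] at this
  linarith

lemma continuousAt_hankelRayIntegral_neg_one {ψ : ℝ} (hψ : 0 < Real.sin ψ)
    (hψ' : Real.cos ψ < 0) : ContinuousAt (fun p ↦ hankelRayIntegral ψ 1 p) (-1) := by
  refine Tendsto.const_mul _ (tendsto_integral_filter_of_dominated_convergence
    (fun t ↦ Real.exp 1 * (Real.exp (-(-Real.cos ψ * t)) *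
      (Real.sin ψ ^ (-2 : ℝ) + (1 + t) ^ (0 : ℝ))))
    (.of_forall fun p ↦ aestronglyMeasurable_cexp_mul_cpow_complexRay ψ 1 p _) ?_
    (integrableOn_cexp_mul_cpow_complexRay_bound hψ' one_pos _ 0) ?_)
  · filter_upwards [Ioo_mem_nhds (show (-2 : ℝ) < -1 by norm_num) (show (-1 : ℝ) < 0 by norm_num)]
      with p hp
    filter_upwards [ae_restrict_mem measurableSet_Ioi] with t ht
    have ht : 0 < t := ht
    refine (norm_cexp_mul_cpow_complexRay_le hψ one_pos le_rfl le_rfl ht.le p).trans ?_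
    rw [one_mul]
    gcongr ?_ * (?_ * (?_ + ?_))
    · exact Real.rpow_le_rpow_of_exponent_ge hψ (Real.sin_le_one ψ) hp.1.le
    · exact Real.rpow_le_rpow_of_exponent_le (by linarith) hp.2.le
  · filter_upwards [ae_restrict_mem measurableSet_Ioi] with t ht
    have hne := slitPlane_ne_zero (complexRay_mem_slitPlane hψ one_pos (le_of_lt ht))
    have hcont : Continuous fun p : ℝ ↦
        cexp (complexRay ψ 1 t) * complexRay ψ 1 t ^ (p : ℂ) :=
      continuous_const.mul (continuous_ofReal.const_cpow (.inl hne))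
    exact hcont.tendsto _

/-- Hankel's formula for the reciprocal of the Gamma function. -/
theorem im_hankelRayIntegral {ψ : ℝ} (hψ : Real.pi / 2 < ψ) (hψ' : ψ < Real.pi) (p : ℝ) :
    (hankelRayIntegral ψ 1 p).im = Real.pi * (Real.Gamma (-p))⁻¹ := by
  have hpi := Real.pi_pos
  have hsin : 0 < Real.sin ψ := Real.sin_pos_of_pos_of_lt_pi (by linarith) hψ'
  have hcos : Real.cos ψ < 0 := Real.cos_neg_of_pi_div_two_lt_of_lt hψ (by linarith)
  have hbase : ∀ q ∈ Ico (-1 : ℝ) 0,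
      (hankelRayIntegral ψ 1 q).im = Real.pi * (Real.Gamma (-q))⁻¹ := by
    rintro q ⟨hq, hq'⟩
    rcases hq.eq_or_lt with rfl | hq
    · have hleft := ((continuous_im.tendsto _).comp
        (continuousAt_hankelRayIntegral_neg_one hsin hcos).tendsto).mono_left
          (nhdsWithin_le_nhds (s := Ioi (-1)))
      have hG : ContinuousAt (fun q : ℝ ↦ Real.pi * (Real.Gamma (-q))⁻¹) (-1) := by
        refine continuousAt_const.mul (ContinuousAt.inv₀ ?_ (by simp))
        refine ContinuousAt.comp_of_eq (g := Real.Gamma) (y := 1) ?_ continuousAt_neg (by simp)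
        exact (Real.differentiableAt_Gamma fun m ↦ by
          have : (0 : ℝ) ≤ m := m.cast_nonneg
          linarith).continuousAt
      refine tendsto_nhds_unique hleft
        ((hG.tendsto.mono_left (nhdsWithin_le_nhds (s := Ioi (-1)))).congr' ?_)
      filter_upwards [Ioo_mem_nhdsGT (show (-1 : ℝ) < 0 by norm_num)] with x hx
      exact (im_hankelRayIntegral_of_mem_Ioo hψ hψ' hx).symm
    · exact im_hankelRayIntegral_of_mem_Ioo hψ hψ' ⟨hq, hq'⟩
  have hshift (n : ℤ) : ∀ q ∈ Ico (-1 : ℝ) 0,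
      (hankelRayIntegral ψ 1 (q + n)).im = Real.pi * (Real.Gamma (-(q + n)))⁻¹ := by
    induction n with
    | zero => simpa using hbase
    | succ n ih =>
      intro q hq
      have ih := ih q hq
      push_cast at ih ⊢
      rw [im_hankelRayIntegral_sub_one hsin hcos, show q + (n + 1 : ℝ) - 1 = q + n by ring, ih]
      rcases eq_or_ne (q + (n + 1 : ℝ)) 0 with h0 | h0
      · simp [h0, Real.Gamma_zero]
      · have := Real.Gamma_add_one (neg_ne_zero.2 h0)
        rw [show -(q + (n + 1 : ℝ)) + 1 = -(q + n) by ring] at this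
        rw [this, mul_inv]
        field_simp
    | pred n ih =>
      intro q hq
      have ih := ih q hq
      push_cast at ih ⊢
      have h0 : -(q + -(n : ℝ)) ≠ 0 := by
        have : (0 : ℝ) ≤ n := n.cast_nonneg
        linarith [hq.2]
      have hG := Real.Gamma_add_one h0
      rw [im_hankelRayIntegral_sub_one hsin hcos] at ih
      rw [show q + (-(n : ℝ) - 1) = q + -n - 1 by ring,
        show -(q + -(n : ℝ) - 1) = -(q + -n) + 1 by ring, hG, mul_inv]
      refine mul_left_cancel₀ h0 (ih.trans ?_)
      rw [mul_left_comm, mul_inv_cancel_left₀ h0]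
  have hmem : p - (⌊p⌋ + 1 : ℤ) ∈ Ico (-1 : ℝ) 0 := by
    push_cast
    constructor <;> linarith [Int.floor_le p, Int.lt_floor_add_one p]
  simpa using hshift (⌊p⌋ + 1) _ hmem

lemma hasSum_integral_cexp_mul_cpow_complexRay {ψ α : ℝ} (hψ : 0 < Real.sin ψ)
    (hψ' : Real.cos ψ < 0) (hα : 0 < α) (hα' : α < 1) (θ : ℝ) :
    HasSum (fun k : ℕ ↦ ∫ t in Ioi (0 : ℝ), (((-θ) ^ k / k.factorial : ℝ) : ℂ) *
        (cexp (complexRay ψ 1 t) * complexRay ψ 1 t ^ ((α * (k + 1) - 1 : ℝ) : ℂ)))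
      (∫ t in Ioi (0 : ℝ), cexp (complexRay ψ 1 t) * complexRay ψ 1 t ^ ((α - 1 : ℝ) : ℂ) *
        cexp (-(complexRay ψ 1 t ^ (α : ℂ) * θ))) := by
  have hsplit (k : ℕ) {t : ℝ} (ht : 0 < t) : (((-θ) ^ k / k.factorial : ℝ) : ℂ) *
      (cexp (complexRay ψ 1 t) * complexRay ψ 1 t ^ ((α * (k + 1) - 1 : ℝ) : ℂ)) =
      cexp (complexRay ψ 1 t) * complexRay ψ 1 t ^ ((α - 1 : ℝ) : ℂ) *
        ((-(complexRay ψ 1 t ^ (α : ℂ) * θ)) ^ k / k.factorial) := by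
    have hne := slitPlane_ne_zero (complexRay_mem_slitPlane hψ one_pos ht.le)
    rw [show ((α * (k + 1) - 1 : ℝ) : ℂ) = ((α - 1 : ℝ) : ℂ) + α * k by push_cast; ring,
      cpow_add _ _ hne, cpow_mul_nat, ← mul_neg, mul_pow]
    push_cast
    ring
  have hexp (z : ℂ) : HasSum (fun k : ℕ ↦ z ^ k / k.factorial) (cexp z) := by
    rw [Complex.exp_eq_exp_ℂ]
    exact NormedSpace.expSeries_div_hasSum_exp z
  have hrexp (x : ℝ) : HasSum (fun k : ℕ ↦ x ^ k / k.factorial) (Real.exp x) := by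
    rw [Real.exp_eq_exp_ℝ]
    exact NormedSpace.expSeries_div_hasSum_exp x
  have hsum (t : ℝ) := (hrexp (‖complexRay ψ 1 t‖ ^ α * |θ|)).mul_left
    ‖cexp (complexRay ψ 1 t) * complexRay ψ 1 t ^ ((α - 1 : ℝ) : ℂ)‖
  have hmeas := measurable_complexRay ψ 1
  refine hasSum_integral_of_dominated_convergence
    (fun k t ↦ ‖cexp (complexRay ψ 1 t) * complexRay ψ 1 t ^ ((α - 1 : ℝ) : ℂ)‖ *
      ((‖complexRay ψ 1 t‖ ^ α * |θ|) ^ k / k.factorial))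
    (fun k ↦ (aestronglyMeasurable_cexp_mul_cpow_complexRay ψ 1 _ _).const_mul _) (fun k ↦ ?_)
    (.of_forall fun t ↦ (hsum t).summable) ?_ ?_
  · filter_upwards [ae_restrict_mem measurableSet_Ioi] with t ht
    rw [hsplit k ht, norm_mul, norm_div, norm_pow, norm_neg,
      norm_mul (_ ^ (α : ℂ)) (θ : ℂ), norm_cpow_real, norm_real, Real.norm_eq_abs, norm_natCast]
  · simp only [fun t ↦ (hsum t).tsum_eq]
    have hbound : IntegrableOn (fun t : ℝ ↦ Real.exp 1 * (Real.sin ψ ^ (α - 1) *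
        (Real.exp (-(-Real.cos ψ * t)) * ((1 + t) ^ (0 : ℝ) * Real.exp (|θ| * (1 + t) ^ α))) +
        Real.exp (-(-Real.cos ψ * t)) * ((1 + t) ^ (α - 1) * Real.exp (|θ| * (1 + t) ^ α))))
        (Ioi 0) :=
      (((integrableOn_exp_neg_mul_rpow_mul_exp (by linarith) one_pos hα' 0 |θ|).const_mul _).add
        (integrableOn_exp_neg_mul_rpow_mul_exp (by linarith) one_pos hα' (α - 1) |θ|)).const_mul _
    refine hbound.mono' (by fun_prop) ?_
    filter_upwards [ae_restrict_mem measurableSet_Ioi] with t ht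
    have ht : 0 < t := ht
    rw [Real.norm_of_nonneg (by positivity)]
    calc _ ≤ Real.exp 1 * (Real.exp (-(-Real.cos ψ * t)) *
          ((1 * Real.sin ψ) ^ (α - 1) + (1 + t) ^ (α - 1))) *
            Real.exp ((1 + t) ^ α * |θ|) := by
          gcongr
          · exact norm_cexp_mul_cpow_complexRay_le hψ one_pos le_rfl le_rfl ht.le _
          · exact norm_complexRay_le zero_le_one ht.le
      _ = _ := by
          rw [one_mul, Real.rpow_zero, mul_comm ((1 + t) ^ α)]
          ring
  · filter_upwards [ae_restrict_mem measurableSet_Ioi] with t ht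
    simp only [fun k ↦ hsplit k ht]
    exact (hexp _).mul_left _

/-- Integral representation of the Wright function along a ray. -/
lemma wrightFn_eq_im_integral {ψ α : ℝ} (hψ : Real.pi / 2 < ψ) (hψ' : ψ < Real.pi)
    (hα : 0 < α) (hα' : α < 1) (θ : ℝ) :
    wrightFn α θ = Real.pi⁻¹ * (cexp (ψ * I) *
      ∫ t in Ioi (0 : ℝ), cexp (complexRay ψ 1 t) * complexRay ψ 1 t ^ ((α - 1 : ℝ) : ℂ) *
        cexp (-(complexRay ψ 1 t ^ (α : ℂ) * θ))).im := by
  have hpi := Real.pi_pos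
  have hsin : 0 < Real.sin ψ := Real.sin_pos_of_pos_of_lt_pi (by linarith) hψ'
  have hcos : Real.cos ψ < 0 := Real.cos_neg_of_pi_div_two_lt_of_lt hψ (by linarith)
  have hsum := (hasSum_im ((hasSum_integral_cexp_mul_cpow_complexRay hsin hcos hα hα' θ).mul_left
    (cexp (ψ * I)))).mul_left Real.pi⁻¹
  refine (hsum.congr_fun fun k ↦ ?_).tsum_eq
  rw [integral_const_mul, mul_left_comm, im_ofReal_mul]
  change _ = Real.pi⁻¹ * (_ * (hankelRayIntegral ψ 1 (α * (k + 1) - 1)).im)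
  rw [im_hankelRayIntegral hψ hψ', show -(α * ((k : ℝ) + 1) - 1) = -α * k + 1 - α by ring]
  field_simp

lemma le_re_cpow_complexRay {ψ α t : ℝ} (hψ : Real.pi / 2 < ψ) (hψ' : ψ < Real.pi)
    (hα : 0 < α) (hαψ : α * ψ < Real.pi / 2) (ht : 0 ≤ t) :
    Real.sin ψ ^ α * Real.cos (α * ψ) ≤ (complexRay ψ 1 t ^ (α : ℂ)).re := by
  have hpi := Real.pi_pos
  have hsin : 0 < Real.sin ψ := Real.sin_pos_of_pos_of_lt_pi (by linarith) hψ'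
  have harg := arg_complexRay_mem_Icc hψ hψ' one_pos ht
  have hcos : 0 < Real.cos (α * ψ) := Real.cos_pos_of_mem_Ioo ⟨by nlinarith, hαψ⟩
  rw [cpow_ofReal_re, mul_comm (complexRay ψ 1 t).arg]
  gcongr
  · simpa using mul_sin_le_norm_complexRay ψ 1 t
  · exact Real.cos_le_cos_of_nonneg_of_le_pi (mul_nonneg hα.le harg.1) (by linarith)
      (mul_le_mul_of_nonneg_left harg.2 hα.le)

lemma integrable_wright_kernel {ψ α r : ℝ} (hψ : Real.pi / 2 < ψ) (hψ' : ψ < Real.pi)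
    (hα : 0 < α) (hαψ : α * ψ < Real.pi / 2) (hr : -1 < r) :
    Integrable (Function.uncurry fun θ t : ℝ ↦ cexp (ψ * I) * (((θ ^ r : ℝ) : ℂ) *
      (cexp (complexRay ψ 1 t) * complexRay ψ 1 t ^ ((α - 1 : ℝ) : ℂ) *
        cexp (-(complexRay ψ 1 t ^ (α : ℂ) * θ)))))
      ((volume.restrict (Ioi 0)).prod (volume.restrict (Ioi 0))) := by
  have hpi := Real.pi_pos
  have hsin : 0 < Real.sin ψ := Real.sin_pos_of_pos_of_lt_pi (by linarith) hψ'
  have hcos : Real.cos ψ < 0 := Real.cos_neg_of_pi_div_two_lt_of_lt hψ (by linarith)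
  have hδ : 0 < Real.sin ψ ^ α * Real.cos (α * ψ) :=
    mul_pos (by positivity) (Real.cos_pos_of_mem_Ioo ⟨by nlinarith, hαψ⟩)
  have hmeas := measurable_complexRay ψ 1
  refine ((integrableOn_rpow_mul_exp_neg_mul hr hδ).mul_prod
    (integrableOn_cexp_mul_cpow_complexRay hsin hcos one_pos (α - 1)).norm).mono'
    (Measurable.aestronglyMeasurable (by unfold Function.uncurry; fun_prop)) ?_
  rw [Measure.prod_restrict]
  filter_upwards [ae_restrict_mem (measurableSet_Ioi.prod measurableSet_Ioi)] with x hx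
  obtain ⟨θ, t⟩ := x
  have hθ : 0 < θ := hx.1
  have ht : 0 < t := hx.2
  simp only [Function.uncurry_apply_pair]
  rw [norm_mul, norm_exp_ofReal_mul_I, one_mul, mul_left_comm, norm_mul,
    norm_rpow_mul_cexp_neg_mul hθ, mul_comm]
  gcongr
  exact le_re_cpow_complexRay hψ hψ' hα hαψ ht.le

lemma integral_wright_kernel {ψ α r t : ℝ} (hψ : Real.pi / 2 < ψ) (hψ' : ψ < Real.pi)
    (hα : 0 < α) (hαψ : α * ψ < Real.pi / 2) (hr : -1 < r) (ht : 0 < t) :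
    ∫ θ in Ioi (0 : ℝ), cexp (ψ * I) * (((θ ^ r : ℝ) : ℂ) *
      (cexp (complexRay ψ 1 t) * complexRay ψ 1 t ^ ((α - 1 : ℝ) : ℂ) *
        cexp (-(complexRay ψ 1 t ^ (α : ℂ) * θ)))) =
    Real.Gamma (1 + r) * (cexp (ψ * I) *
      (cexp (complexRay ψ 1 t) * complexRay ψ 1 t ^ ((-1 - α * r : ℝ) : ℂ))) := by
  have hpi := Real.pi_pos
  have hsin : 0 < Real.sin ψ := Real.sin_pos_of_pos_of_lt_pi (by linarith) hψ'
  have hδ : 0 < Real.sin ψ ^ α * Real.cos (α * ψ) :=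
    mul_pos (by positivity) (Real.cos_pos_of_mem_Ioo ⟨by nlinarith, hαψ⟩)
  have hne := slitPlane_ne_zero (complexRay_mem_slitPlane hsin one_pos ht.le)
  have harg := arg_complexRay_mem_Icc hψ hψ' one_pos ht.le
  have hre := hδ.trans_le (le_re_cpow_complexRay hψ hψ' hα hαψ ht.le)
  have hmain := integral_rpow_mul_cexp_neg_mul (a := 1 + r) (by linarith) hre
  rw [add_sub_cancel_left] at hmain
  simp only [mul_left_comm (((_ ^ r : ℝ) : ℂ))]
  rw [integral_const_mul, integral_const_mul, hmain, ← cpow_mul]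
  · rw [show ((-1 - α * r : ℝ) : ℂ) = ((α - 1 : ℝ) : ℂ) + α * -((1 + r : ℝ) : ℂ) by
      push_cast; ring, cpow_add _ _ hne]
    ring
  · rw [im_mul_ofReal, log_im]
    nlinarith [harg.1]
  · rw [im_mul_ofReal, log_im]
    nlinarith [harg.2]

/-- Moments of the Wright function: for `r > −1`,
`∫_0^∞ φ_α(θ) θ^r dθ = Γ(1+r)/Γ(1+αr)`. -/
theorem wrightFn_moments (α : ℝ) (hα : 0 < α) (hα' : α < 1) (r : ℝ) (hr : -1 < r) :
    ∫ θ in Set.Ioi (0:ℝ), wrightFn α θ * θ ^ r =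
      Real.Gamma (1 + r) / Real.Gamma (1 + α * r) := by
  have hpi := Real.pi_pos
  obtain ⟨ψ, hψ, hmin⟩ : ∃ ψ, Real.pi / 2 < ψ ∧ ψ < min Real.pi (Real.pi / 2 / α) :=
    exists_between (lt_min (by linarith) ((lt_div_iff₀ hα).2 (by nlinarith)))
  have hψ' : ψ < Real.pi := hmin.trans_le (min_le_left _ _)
  have hαψ : α * ψ < Real.pi / 2 := by
    rw [mul_comm]
    exact (lt_div_iff₀ hα).1 (hmin.trans_le (min_le_right _ _))
  have hint := integrable_wright_kernel hψ hψ' hα hαψ hr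
  have hrepr (θ : ℝ) : wrightFn α θ * θ ^ r = Real.pi⁻¹ *
      (∫ t in Ioi (0 : ℝ), cexp (ψ * I) * (((θ ^ r : ℝ) : ℂ) *
        (cexp (complexRay ψ 1 t) * complexRay ψ 1 t ^ ((α - 1 : ℝ) : ℂ) *
          cexp (-(complexRay ψ 1 t ^ (α : ℂ) * θ))))).im := by
    rw [wrightFn_eq_im_integral hψ hψ' hα hα', integral_const_mul, integral_const_mul,
      mul_left_comm (cexp (ψ * I)), im_ofReal_mul]
    ring
  have him := imCLM.integral_comp_comm hint.integral_prod_left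
  simp only [Function.uncurry_apply_pair, imCLM_apply] at him
  simp only [hrepr]
  rw [integral_const_mul, him, integral_integral_swap hint,
    setIntegral_congr_fun measurableSet_Ioi
      fun t ht ↦ integral_wright_kernel hψ hψ' hα hαψ hr ht,
    integral_const_mul, integral_const_mul, im_ofReal_mul]
  change Real.pi⁻¹ * (_ * (hankelRayIntegral ψ 1 (-1 - α * r)).im) = _
  rw [im_hankelRayIntegral hψ hψ', show -(-1 - α * r) = 1 + α * r by ring]
  field_simp

end
end

section
/- Let 0 < α < 1 and let φ_α be the Wright type function φ_α(z) = Σ_{k=0}^∞ (−z)^k/(k! Γ(−αk + 1 − α)). Then for every z ∈ ℂ: (i) ∫_0^{+∞} φ_α(θ) e^{−zθ} dθ = E_{α,1}(−z), and (ii) α ∫_0^{+∞} θ φ_α(θ) e^{−zθ} dθ = E_{α,α}(−z). -/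
noncomputable section

/-- Two-parameter Mittag-Leffler function `E_{α,β}(z) = Σ_k z^k / Γ(αk + β)`. -/
def mittagLeffler (α β : ℝ) (z : ℂ) : ℂ :=
  ∑' k : ℕ, z ^ k / Complex.Gamma ((α * (k : ℝ) + β : ℝ) : ℂ)

open MeasureTheory Filter Topology Set Asymptotics

lemma eventually_neg_mul_exp_add_le {α c : ℝ} (hα : α < 1) (hc : 0 < c) (p q : ℝ) :
    ∀ᶠ x : ℝ in atTop,
      -c * Real.exp x + p * x + q * Real.exp (α * x) ≤ -x := by
  have hx : (fun x : ℝ => (p + 1) * x) =o[atTop] Real.exp := by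
    simpa using (Real.isLittleO_pow_exp_atTop (n := 1)).const_mul_left (p + 1)
  have he : (fun x : ℝ => q * Real.exp (α * x)) =o[atTop] Real.exp := by
    refine IsLittleO.const_mul_left ?_ q
    rw [Real.isLittleO_exp_comp_exp_comp]
    have : (fun x : ℝ => x - α * x) = fun x => (1 - α) * x := by ext; ring
    rw [this]
    exact tendsto_id.const_mul_atTop (by linarith)
  filter_upwards [hx.bound (half_pos hc), he.bound (half_pos hc)] with x h1 h2
  simp only [Real.norm_eq_abs, Real.abs_exp] at h1 h2
  linarith [le_abs_self ((p + 1) * x), le_abs_self (q * Real.exp (α * x))]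

/-- The integrand `exp (exp ζ - s ζ)` of Hankel's integral in the logarithmic variable. -/
def hankelKernel (s : ℝ) (ζ : ℂ) : ℂ := Complex.exp (Complex.exp ζ - s * ζ)

lemma differentiable_hankelKernel (s : ℝ) : Differentiable ℂ (hankelKernel s) := by
  unfold hankelKernel; fun_prop

lemma continuous_hankelKernel (s : ℝ) : Continuous (hankelKernel s) :=
  (differentiable_hankelKernel s).continuous

lemma norm_hankelKernel (s : ℝ) (ζ : ℂ) :
    ‖hankelKernel s ζ‖ = Real.exp (Real.exp ζ.re * Real.cos ζ.im - s * ζ.re) := by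
  simp [hankelKernel, Complex.norm_exp, Complex.exp_re]

lemma norm_hankelKernel_add_mul_I (s x y : ℝ) :
    ‖hankelKernel s (x + y * Complex.I)‖ = Real.exp (Real.exp x * Real.cos y - s * x) := by
  simp [norm_hankelKernel]

lemma integrableOn_hankelKernel (s a : ℝ) {y : ℝ} (hy : Real.cos y < 0) :
    IntegrableOn (fun x : ℝ => hankelKernel s (x + y * Complex.I)) (Ioi a) := by
  have hcont : Continuous fun x : ℝ => hankelKernel s (x + y * Complex.I) :=
    (continuous_hankelKernel s).comp (by fun_prop)
  rw [IntegrableOn, ← integrable_norm_iff hcont.aestronglyMeasurable]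
  refine integrable_of_isBigO_exp_neg one_pos hcont.norm.continuousOn ?_
  refine IsBigO.of_bound 1 ?_
  filter_upwards [eventually_neg_mul_exp_add_le (α := 0) one_pos (neg_pos.2 hy) (-s) 0] with x hx
  simp only [norm_hankelKernel_add_mul_I, Real.norm_eq_abs, Real.abs_exp, one_mul]
  exact Real.exp_le_exp.2 (by linarith)

lemma tendsto_integral_hankelKernel_atTop (s : ℝ) {c y₁ y₂ : ℝ} (hc : 0 < c)
    (hy : ∀ y ∈ uIoc y₁ y₂, Real.cos y ≤ -c) :
    Tendsto (fun b : ℝ => ∫ y in y₁..y₂, hankelKernel s (b + y * Complex.I)) atTop (𝓝 0) := by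
  have hlim : Tendsto (fun b : ℝ => Real.exp (-b) * |y₂ - y₁|) atTop (𝓝 0) := by
    simpa using Real.tendsto_exp_neg_atTop_nhds_zero.mul_const |y₂ - y₁|
  refine squeeze_zero_norm' ?_ hlim
  filter_upwards [eventually_neg_mul_exp_add_le (α := 0) one_pos hc (-s) 0] with b hb
  refine intervalIntegral.norm_integral_le_of_norm_le_const fun y hyy => ?_
  rw [norm_hankelKernel_add_mul_I]
  refine Real.exp_le_exp.2 ?_
  nlinarith [mul_le_mul_of_nonneg_left (hy y hyy) (Real.exp_pos b).le]

/-- Cauchy's theorem for `hankelKernel` on a half-strip. -/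
lemma integral_Ioi_hankelKernel_sub (s a : ℝ) {c y₁ y₂ : ℝ} (hc : 0 < c)
    (hy : ∀ y ∈ uIcc y₁ y₂, Real.cos y ≤ -c) :
    (∫ x in Ioi a, hankelKernel s (x + y₁ * Complex.I)) -
        ∫ x in Ioi a, hankelKernel s (x + y₂ * Complex.I) =
      Complex.I * ∫ y in y₁..y₂, hankelKernel s (a + y * Complex.I) := by
  have h1 := intervalIntegral_tendsto_integral_Ioi a (integrableOn_hankelKernel s a
    (y := y₁) (by linarith [hy _ left_mem_uIcc])) tendsto_id
  have h2 := intervalIntegral_tendsto_integral_Ioi a (integrableOn_hankelKernel s a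
    (y := y₂) (by linarith [hy _ right_mem_uIcc])) tendsto_id
  have h3 := tendsto_integral_hankelKernel_atTop s hc fun y h => hy y (uIoc_subset_uIcc h)
  have h4 := (h1.sub h2).add (h3.const_mul Complex.I)
  rw [mul_zero, add_zero] at h4
  refine tendsto_nhds_unique h4 (tendsto_const_nhds.congr fun b => ?_)
  have := Complex.integral_boundary_rect_eq_zero_of_differentiableOn (hankelKernel s)
    (a + y₁ * Complex.I) (b + y₂ * Complex.I) (differentiable_hankelKernel s).differentiableOn
  simp only [Complex.add_re, Complex.add_im, Complex.ofReal_re, Complex.ofReal_im, Complex.mul_re,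
    Complex.mul_im, Complex.I_re, Complex.I_im, mul_zero, mul_one, sub_zero, add_zero, zero_add,
    smul_eq_mul] at this
  simp only [id]
  linear_combination -this

/-- The integral of `f` along the contour `+∞ - iψ → a - iψ → a + iψ → +∞ + iψ`. -/
def hankelSides (a ψ : ℝ) (f : ℂ → ℂ) : ℂ :=
  (∫ x : ℝ in Ioi a, f (x + ψ * Complex.I)) - (∫ x : ℝ in Ioi a, f (x + (-ψ : ℝ) * Complex.I)) +
    Complex.I * ∫ y in (-ψ)..ψ, f (a + y * Complex.I)

lemma hankelSides_angle (s a : ℝ) {ψ : ℝ} (h1 : Real.pi / 2 < ψ) (h2 : ψ ≤ Real.pi) :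
    hankelSides a ψ (hankelKernel s) = hankelSides a Real.pi (hankelKernel s) := by
  have hc : 0 < -Real.cos ψ :=
    neg_pos.2 (Real.cos_neg_of_pi_div_two_lt_of_lt h1 (by linarith [Real.pi_pos]))
  have hup := integral_Ioi_hankelKernel_sub s a (y₁ := ψ) (y₂ := Real.pi) hc fun y hy => by
    rw [uIcc_of_le h2] at hy
    rw [neg_neg]
    exact Real.cos_le_cos_of_nonneg_of_le_pi (by linarith [Real.pi_pos]) hy.2 hy.1
  have hdown := integral_Ioi_hankelKernel_sub s a (y₁ := -Real.pi) (y₂ := -ψ) hc fun y hy => by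
    rw [uIcc_of_le (by linarith)] at hy
    rw [neg_neg, ← Real.cos_neg y]
    exact Real.cos_le_cos_of_nonneg_of_le_pi (by linarith [Real.pi_pos]) (by linarith [hy.1])
      (by linarith [hy.2])
  have hi : ∀ u v : ℝ, IntervalIntegrable (fun y : ℝ => hankelKernel s (a + y * Complex.I))
      volume u v := fun u v =>
    ((continuous_hankelKernel s).comp (by fun_prop)).intervalIntegrable u v
  have hs1 := intervalIntegral.integral_add_adjacent_intervals (hi (-Real.pi) (-ψ)) (hi (-ψ) ψ)
  have hs2 := intervalIntegral.integral_add_adjacent_intervals (hi (-Real.pi) ψ) (hi ψ Real.pi)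
  unfold hankelSides
  rw [← hs2, ← hs1]
  linear_combination hup + hdown

lemma hankelSides_endpoint (s a b : ℝ) {ψ : ℝ} (hψ : Real.cos ψ < 0) :
    hankelSides a ψ (hankelKernel s) = hankelSides b ψ (hankelKernel s) := by
  have h1 := intervalIntegral.integral_interval_add_Ioi (integrableOn_hankelKernel s a hψ)
    (integrableOn_hankelKernel s b hψ)
  have hψ' : Real.cos (-ψ) < 0 := by rwa [Real.cos_neg]
  have h2 := intervalIntegral.integral_interval_add_Ioi (integrableOn_hankelKernel s a hψ')
    (integrableOn_hankelKernel s b hψ')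
  have := Complex.integral_boundary_rect_eq_zero_of_differentiableOn (hankelKernel s)
    (a + (-ψ : ℝ) * Complex.I) (b + ψ * Complex.I)
    (differentiable_hankelKernel s).differentiableOn
  simp only [Complex.add_re, Complex.add_im, Complex.ofReal_re, Complex.ofReal_im, Complex.mul_re,
    Complex.mul_im, Complex.I_re, Complex.I_im, mul_zero, mul_one, sub_zero, add_zero, zero_add,
    smul_eq_mul] at this
  unfold hankelSides
  rw [← h1, ← h2]
  linear_combination -this

lemma hankelSides_eq_of_neg (a : ℝ) {s : ℝ} (hs : s < 0) {ψ : ℝ} (h1 : Real.pi / 2 < ψ)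
    (h2 : ψ ≤ Real.pi) :
    hankelSides a ψ (hankelKernel s) =
      -(2 * Complex.I * Complex.sin (Real.pi * s)) * Complex.Gamma (-s) := by
  rw [hankelSides_angle s a h1 h2]
  have hpi : Real.cos Real.pi < 0 := by simp
  have hint := Complex.GammaIntegral_convergent (s := -s) (by simpa using hs)
  have hg : Tendsto (fun b : ℝ => ∫ r in Ioi (Real.exp b),
      ((Real.exp (-r) : ℝ) : ℂ) * (r : ℂ) ^ (-(s : ℂ) - 1)) atBot (𝓝 (Complex.Gamma (-s))) := by
    rw [Complex.Gamma_eq_integral (by simpa using hs), Complex.GammaIntegral]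
    have := (aecover_Ioi_of_Ioi (μ := volume) Real.tendsto_exp_atBot)
      |>.integral_tendsto_of_countably_generated hint
    refine this.congr fun b => ?_
    rw [Measure.restrict_restrict measurableSet_Ioi,
      inter_eq_left.2 (Ioi_subset_Ioi (Real.exp_pos b).le)]
  have hline : ∀ (b y : ℝ), y = Real.pi ∨ y = -Real.pi →
      ∫ x : ℝ in Ioi b, hankelKernel s (x + y * Complex.I) =
      Complex.exp (-(s * y * Complex.I)) * ∫ r in Ioi (Real.exp b),
      ((Real.exp (-r) : ℝ) : ℂ) * (r : ℂ) ^ (-(s : ℂ) - 1) := by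
    intro b y hy
    rw [← integral_comp_exp_Ioi, ← integral_const_mul]
    refine setIntegral_congr_fun measurableSet_Ioi fun x _ => ?_
    have hey : Complex.exp (y * Complex.I) = -1 := by
      rcases hy with rfl | rfl <;> simp [Complex.exp_neg]
    have hx : ((Real.exp x : ℝ) : ℂ) ≠ 0 := by simp
    simp only [hankelKernel, Complex.exp_add, hey, Complex.real_smul]
    rw [Complex.cpow_def_of_ne_zero hx, ← Complex.ofReal_log (Real.exp_pos x).le, Real.log_exp]
    push_cast
    rw [← Complex.exp_add, ← Complex.exp_add, ← Complex.exp_add]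
    congr 1
    ring
  have hvert : Tendsto (fun b : ℝ => ∫ y in (-Real.pi)..Real.pi,
      hankelKernel s (b + y * Complex.I)) atBot (𝓝 0) := by
    have hlim : Tendsto (fun b : ℝ => Real.exp (Real.exp b - s * b) * |Real.pi - -Real.pi|)
        atBot (𝓝 0) := by
      rw [← zero_mul |Real.pi - -Real.pi|]
      refine Tendsto.mul_const _ (Real.tendsto_exp_atBot.comp ?_)
      have : Tendsto (fun b : ℝ => (-s) * b) atBot atBot :=
        tendsto_id.const_mul_atBot (by linarith)
      refine (Real.tendsto_exp_atBot.add_atBot this).congr fun b => by ring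
    refine squeeze_zero_norm' (Eventually.of_forall fun b => ?_) hlim
    refine intervalIntegral.norm_integral_le_of_norm_le_const fun y hyy => ?_
    rw [norm_hankelKernel_add_mul_I]
    refine Real.exp_le_exp.2 ?_
    nlinarith [Real.exp_pos b, Real.cos_le_one y]
  have hlim : Tendsto (fun b => hankelSides b Real.pi (hankelKernel s)) atBot
      (𝓝 (Complex.exp (-(s * Real.pi * Complex.I)) * Complex.Gamma (-s) -
        Complex.exp (-(s * (-Real.pi : ℝ) * Complex.I)) * Complex.Gamma (-s) +
        Complex.I * 0)) := by
    refine (((hg.const_mul _).sub (hg.const_mul _)).add (hvert.const_mul _)).congr fun b => ?_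
    rw [hankelSides, hline b _ (Or.inl rfl), hline b _ (Or.inr rfl)]
  rw [tendsto_nhds_unique (tendsto_const_nhds.congr fun b =>
    hankelSides_endpoint s a b hpi) hlim, Complex.sin]
  push_cast
  rw [show -((s : ℂ) * Real.pi * Complex.I) = -(Real.pi * s) * Complex.I by ring,
    show -((s : ℂ) * -Real.pi * Complex.I) = (Real.pi * s) * Complex.I by ring]
  linear_combination
    (Complex.exp (-(Real.pi * s) * Complex.I) - Complex.exp (Real.pi * s * Complex.I)) *
      Complex.Gamma (-s) * Complex.I_sq

lemma hankelSides_zero (a : ℝ) {ψ : ℝ} (h1 : Real.pi / 2 < ψ) (h2 : ψ ≤ Real.pi) :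
    hankelSides a ψ (hankelKernel 0) = 2 * Real.pi * Complex.I := by
  rw [hankelSides_angle 0 a h1 h2]
  have hper : ∀ x : ℝ, hankelKernel 0 (x + (-Real.pi : ℝ) * Complex.I) =
      hankelKernel 0 (x + Real.pi * Complex.I) := fun x => by
    simp [hankelKernel, Complex.exp_add, Complex.exp_neg]
  have hvert : Tendsto (fun b : ℝ => ∫ y in (-Real.pi)..Real.pi,
      (hankelKernel 0 (b + y * Complex.I) - 1)) atBot (𝓝 0) := by
    have hlim : Tendsto (fun b : ℝ => 2 * Real.exp b * |Real.pi - -Real.pi|) atBot (𝓝 0) := by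
      simpa using (Real.tendsto_exp_atBot.const_mul 2).mul_const |Real.pi - -Real.pi|
    refine squeeze_zero_norm' ?_ hlim
    filter_upwards [eventually_le_atBot 0] with b hb
    refine intervalIntegral.norm_integral_le_of_norm_le_const fun y _ => ?_
    have hn : ‖Complex.exp (b + y * Complex.I)‖ = Real.exp b := by simp [Complex.norm_exp]
    have := Complex.norm_exp_sub_one_le (x := Complex.exp (b + y * Complex.I))
      (by rw [hn]; exact Real.exp_le_one_iff.2 hb)
    simpa [hankelKernel, hn] using this
  have hlim : Tendsto (fun b => hankelSides b Real.pi (hankelKernel 0)) atBot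
      (𝓝 (Complex.I * 0 + 2 * Real.pi * Complex.I)) := by
    refine ((hvert.const_mul Complex.I).add_const (2 * Real.pi * Complex.I)).congr fun b => ?_
    have hc : Continuous fun y : ℝ => hankelKernel 0 (b + y * Complex.I) :=
      (continuous_hankelKernel 0).comp (by fun_prop)
    rw [intervalIntegral.integral_sub (hc.intervalIntegrable _ _) intervalIntegrable_const]
    simp only [hankelSides, hper, intervalIntegral.integral_const, sub_neg_eq_add,
      Complex.real_smul]
    push_cast
    ring
  rw [tendsto_nhds_unique (tendsto_const_nhds.congr fun b =>
    hankelSides_endpoint 0 a b (by simp)) hlim, mul_zero, zero_add]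

lemma hasDerivAt_hankelKernel (s : ℝ) (ζ : ℂ) :
    HasDerivAt (hankelKernel s) (hankelKernel (s - 1) ζ - s * hankelKernel s ζ) ζ := by
  have h := ((Complex.hasDerivAt_exp ζ).sub ((hasDerivAt_id ζ).const_mul (s : ℂ))).cexp
  convert! h using 1
  simp only [hankelKernel, mul_one, id, mul_sub, Pi.sub_apply]
  rw [← Complex.exp_add]
  congr 1
  · congr 1; push_cast; ring
  · ring

lemma hankelSides_sub_one (s a : ℝ) {ψ : ℝ} (hψ : Real.cos ψ < 0) :
    hankelSides a ψ (hankelKernel (s - 1)) = s * hankelSides a ψ (hankelKernel s) := by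
  have hside : ∀ y : ℝ, Real.cos y < 0 →
      (∫ x : ℝ in Ioi a, hankelKernel (s - 1) (x + y * Complex.I)) -
        s * (∫ x : ℝ in Ioi a, hankelKernel s (x + y * Complex.I)) =
      -hankelKernel s (a + y * Complex.I) := by
    intro y hy
    have hd : ∀ x : ℝ, HasDerivAt (fun x : ℝ => hankelKernel s (x + y * Complex.I))
        (hankelKernel (s - 1) (x + y * Complex.I) - s * hankelKernel s (x + y * Complex.I)) x :=
      fun x => ((hasDerivAt_hankelKernel s _).comp_add_const (x : ℂ) (y * Complex.I)).comp_ofReal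
    have i1 := integrableOn_hankelKernel (s - 1) a hy
    have i2 := (integrableOn_hankelKernel s a hy).const_mul (s : ℂ)
    have h0 := tendsto_zero_of_hasDerivAt_of_integrableOn_Ioi (a := a) (fun x _ => hd x)
      (i1.sub i2) (integrableOn_hankelKernel s a hy)
    rw [← integral_const_mul, ← integral_sub i1 i2,
      integral_Ioi_of_hasDerivAt_of_tendsto' (fun x _ => hd x) (i1.sub i2) h0, zero_sub]
  have hvert : Complex.I * (∫ y in (-ψ)..ψ, hankelKernel (s - 1) (a + y * Complex.I)) -
      s * (Complex.I * ∫ y in (-ψ)..ψ, hankelKernel s (a + y * Complex.I)) =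
      hankelKernel s (a + ψ * Complex.I) - hankelKernel s (a + (-ψ : ℝ) * Complex.I) := by
    have hd : ∀ y : ℝ, HasDerivAt (fun y : ℝ => hankelKernel s (a + y * Complex.I))
        ((hankelKernel (s - 1) (a + y * Complex.I) - s * hankelKernel s (a + y * Complex.I)) *
          Complex.I) y := fun y => by
      have h := ((hasDerivAt_id (y : ℂ)).mul_const Complex.I).const_add (a : ℂ)
      rw [one_mul] at h
      exact ((hasDerivAt_hankelKernel s _).comp (y : ℂ) h).comp_ofReal
    have hc : ∀ s' : ℝ, Continuous fun y : ℝ => hankelKernel s' (a + y * Complex.I) :=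
      fun s' => (continuous_hankelKernel s').comp (by fun_prop)
    rw [← intervalIntegral.integral_eq_sub_of_hasDerivAt (fun y _ => hd y)
      ((((hc _).sub ((hc _).const_mul _)).mul_const _).intervalIntegrable _ _),
      intervalIntegral.integral_mul_const, intervalIntegral.integral_sub
      ((hc _).intervalIntegrable _ _) (((hc _).const_mul _).intervalIntegrable _ _),
      intervalIntegral.integral_const_mul]
    ring
  have hu := hside ψ hψ
  have hl := hside (-ψ) (by rwa [Real.cos_neg])
  unfold hankelSides
  linear_combination hu - hl + hvert

/-- Hankel's formula for the reciprocal Gamma function. -/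
lemma hankelSides_hankelKernel (s a : ℝ) {ψ : ℝ} (h1 : Real.pi / 2 < ψ) (h2 : ψ ≤ Real.pi) :
    hankelSides a ψ (hankelKernel s) = 2 * Real.pi * Complex.I / Complex.Gamma (1 + s) := by
  have hψ := Real.cos_neg_of_pi_div_two_lt_of_lt h1 (by linarith [Real.pi_pos])
  have key : ∀ n : ℕ, ∀ s : ℝ, s < n →
      hankelSides a ψ (hankelKernel s) = 2 * Real.pi * Complex.I / Complex.Gamma (1 + s) := by
    intro n
    induction n with
    | zero =>
      intro s hs
      rw [hankelSides_eq_of_neg a (by simpa using hs) h1 h2]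
      have hr := Complex.Gamma_mul_Gamma_one_sub (-s)
      have hG : Complex.Gamma (-s) ≠ 0 :=
        Complex.Gamma_ne_zero_of_re_pos (by simpa using hs)
      have hpi : (Real.pi : ℂ) ≠ 0 := by simp [Real.pi_ne_zero]
      rw [sub_neg_eq_add, mul_neg, Complex.sin_neg] at hr
      by_cases hsin : Complex.sin (Real.pi * s) = 0
      · rw [hsin, neg_zero, div_zero, mul_eq_zero, or_iff_right hG] at hr
        simp [hsin, hr]
      · have hG' : Complex.Gamma (1 + s) ≠ 0 := by
          intro h
          rw [h, mul_zero] at hr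
          exact div_ne_zero hpi (neg_ne_zero.2 hsin) hr.symm
        rw [eq_div_iff (neg_ne_zero.2 hsin)] at hr
        rw [eq_div_iff hG']
        linear_combination 2 * Complex.I * hr
    | succ n ih =>
      intro s hs
      rcases eq_or_ne s 0 with rfl | hs0
      · simp [hankelSides_zero a h1 h2]
      · have h := ih (s - 1) (by push_cast at hs; linarith)
        rw [hankelSides_sub_one s a hψ] at h
        have hsc : (s : ℂ) ≠ 0 := by exact_mod_cast hs0
        have hG := Complex.Gamma_add_one (s : ℂ) hsc
        rw [show (1 : ℂ) + (s - 1 : ℝ) = s by push_cast; ring] at h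
        rw [add_comm, hG, ← mul_right_inj' hsc, h]
        field_simp
  obtain ⟨n, hn⟩ := exists_nat_gt s
  exact key n s hn

/-- The contour `+∞ - iψ → a - iψ → a + iψ → +∞ + iψ`, parametrised by arc length. -/
def hankelPath (a ψ t : ℝ) : ℂ :=
  ((a + max (|t| - ψ) 0 : ℝ) : ℂ) + ((max (-ψ) (min ψ t) : ℝ) : ℂ) * Complex.I

/-- The unit tangent of `hankelPath`. -/
def hankelDir (ψ t : ℝ) : ℂ := if t ≤ -ψ then -1 else if t ≤ ψ then Complex.I else 1

lemma norm_hankelDir (ψ t : ℝ) : ‖hankelDir ψ t‖ = 1 := by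
  unfold hankelDir; split_ifs <;> simp

lemma measurable_hankelDir (ψ : ℝ) : Measurable (hankelDir ψ) :=
  Measurable.ite measurableSet_Iic measurable_const
    (Measurable.ite measurableSet_Iic measurable_const measurable_const)

lemma continuous_hankelPath (a ψ : ℝ) : Continuous (hankelPath a ψ) := by
  unfold hankelPath; fun_prop

lemma hankelPath_re (a ψ t : ℝ) : (hankelPath a ψ t).re = a + max (|t| - ψ) 0 := by
  simp [hankelPath]

lemma hankelPath_im (a ψ t : ℝ) : (hankelPath a ψ t).im = max (-ψ) (min ψ t) := by
  simp [hankelPath]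

lemma le_hankelPath_re (a ψ t : ℝ) : a ≤ (hankelPath a ψ t).re := by
  rw [hankelPath_re]; linarith [le_max_right (|t| - ψ) 0]

lemma abs_hankelPath_im_le (a t : ℝ) {ψ : ℝ} (hψ : 0 < ψ) : |(hankelPath a ψ t).im| ≤ ψ := by
  rw [hankelPath_im, abs_le]
  exact ⟨le_max_left _ _, max_le (by linarith) (min_le_left _ _)⟩

lemma hankelPath_neg (a t : ℝ) {ψ : ℝ} (hψ : 0 < ψ) :
    hankelPath a ψ (-t) = (starRingEnd ℂ) (hankelPath a ψ t) := by
  refine Complex.ext ?_ ?_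
  · simp [hankelPath_re]
  · rw [Complex.conj_im, hankelPath_im, hankelPath_im]
    rcases le_total t ψ with h | h <;> rcases le_total (-ψ) t with h' | h' <;>
      grind

lemma hankelPath_of_le (a : ℝ) {ψ t : ℝ} (hψ : 0 < ψ) (ht : ψ ≤ t) :
    hankelPath a ψ t = ((a + (t - ψ) : ℝ) : ℂ) + ψ * Complex.I := by
  rw [hankelPath, abs_of_pos (hψ.trans_le ht), max_eq_left (by linarith), min_eq_left ht,
    max_eq_right (by linarith)]

lemma hankelPath_of_mem_Icc (a : ℝ) {ψ t : ℝ} (ht : t ∈ Icc (-ψ) ψ) :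
    hankelPath a ψ t = a + t * Complex.I := by
  rw [hankelPath, max_eq_right (by linarith [abs_le.2 ht]), min_eq_right ht.2, max_eq_right ht.1,
    add_zero]

lemma integrable_exp_hankelPath (a p q : ℝ) {α ψ : ℝ} (hα : α < 1) (h0 : 0 < ψ)
    (hψ : Real.cos ψ < 0) :
    Integrable fun t : ℝ => Real.exp (Real.exp (hankelPath a ψ t).re *
      Real.cos (hankelPath a ψ t).im + p * (hankelPath a ψ t).re +
      q * Real.exp (α * (hankelPath a ψ t).re)) := by
  have hc := continuous_hankelPath a ψ
  have hre := Complex.continuous_re.comp hc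
  have him := Complex.continuous_im.comp hc
  simp only [Function.comp_def] at hre him
  refine LocallyIntegrable.integrable_of_isBigO_atTop_of_norm_isNegInvariant
    (g := fun t => Real.exp (-t)) (Continuous.locallyIntegrable (by fun_prop)) ?_ ?_ ?_
  · refine Eventually.of_forall fun t => ?_
    simp [Function.comp_def, hankelPath_neg a t h0]
  · refine IsBigO.of_bound (Real.exp (ψ - a)) ?_
    have ht : Tendsto (fun t : ℝ => t + (a - ψ)) atTop atTop :=
      tendsto_atTop_add_const_right _ _ tendsto_id
    filter_upwards [ht.eventually (eventually_neg_mul_exp_add_le hα (neg_pos.2 hψ) p q),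
      eventually_ge_atTop ψ] with t h1 h2
    rw [hankelPath_of_le a h0 h2]
    simp only [Complex.add_re, Complex.add_im, Complex.ofReal_re, Complex.ofReal_im,
      Complex.mul_re, Complex.mul_im, Complex.I_re, Complex.I_im, mul_zero, mul_one, sub_zero,
      add_zero, zero_add, Real.norm_eq_abs, Real.abs_exp]
    rw [← Real.exp_add, Real.exp_le_exp, show a + (t - ψ) = t + (a - ψ) by ring]
    linarith
  · exact ⟨Ioi 0, Ioi_mem_atTop 0, integrableOn_exp_neg_Ioi 0⟩

lemma integrable_norm_hankelKernel (s a : ℝ) {ψ : ℝ} (h0 : 0 < ψ) (hψ : Real.cos ψ < 0) :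
    Integrable fun t : ℝ => ‖hankelKernel s (hankelPath a ψ t)‖ := by
  refine (integrable_exp_hankelPath a (-s) 0 (α := 0) one_pos h0 hψ).congr
    (Eventually.of_forall fun t => ?_)
  simp only [norm_hankelKernel]
  congr 1
  ring

lemma integral_hankelPath {a ψ : ℝ} (h0 : 0 < ψ) {f : ℂ → ℂ}
    (hf : Integrable fun t : ℝ => f (hankelPath a ψ t) * hankelDir ψ t) :
    ∫ t : ℝ, f (hankelPath a ψ t) * hankelDir ψ t = hankelSides a ψ f := by
  have hshift : ∀ g : ℝ → ℂ, ∫ t in Ioi ψ, g (a + (t - ψ)) = ∫ x in Ioi a, g x := fun g => by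
    have := (measurePreserving_add_right volume (a - ψ)).setIntegral_preimage_emb
      (measurableEmbedding_addRight (a - ψ)) g (Ioi a)
    rw [← this]
    simp only [preimage_add_const_Ioi, sub_sub_cancel]
    refine setIntegral_congr_fun measurableSet_Ioi fun t _ => ?_
    congr 1
    ring
  rw [← intervalIntegral.integral_Iic_add_Ioi hf.integrableOn hf.integrableOn (b := -ψ),
    ← intervalIntegral.integral_interval_add_Ioi hf.integrableOn hf.integrableOn (b := ψ)]
  have hl : ∫ t in Iic (-ψ), f (hankelPath a ψ t) * hankelDir ψ t =
      -∫ x : ℝ in Ioi a, f (x + (-ψ : ℝ) * Complex.I) := by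
    rw [← hshift fun x => f (x + (-ψ : ℝ) * Complex.I), ← integral_neg]
    have := integral_comp_neg_Iic (-ψ) fun t : ℝ =>
      -f ((a + (t - ψ) : ℝ) + (-ψ : ℝ) * Complex.I)
    rw [neg_neg] at this
    rw [← this]
    refine setIntegral_congr_fun measurableSet_Iic fun t ht => ?_
    have ht' : ψ ≤ -t := by linarith [mem_Iic.1 ht]
    have hp : hankelPath a ψ t = (a + (-t - ψ) : ℝ) + (-ψ : ℝ) * Complex.I := by
      rw [← neg_neg t, hankelPath_neg a _ h0, hankelPath_of_le a h0 ht']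
      simp
    simp only [hp, hankelDir, if_pos (mem_Iic.1 ht), mul_neg, mul_one]
  have hm : ∫ t in (-ψ)..ψ, f (hankelPath a ψ t) * hankelDir ψ t =
      Complex.I * ∫ y in (-ψ)..ψ, f (a + y * Complex.I) := by
    rw [← intervalIntegral.integral_const_mul,
      intervalIntegral.integral_of_le (by linarith), intervalIntegral.integral_of_le (by linarith)]
    refine setIntegral_congr_fun measurableSet_Ioc fun t ht => ?_
    simp only [hankelPath_of_mem_Icc a (Ioc_subset_Icc_self ht), hankelDir, if_neg (not_le.2 ht.1),
      if_pos ht.2, mul_comm]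
  have hr : ∫ t in Ioi ψ, f (hankelPath a ψ t) * hankelDir ψ t =
      ∫ x : ℝ in Ioi a, f (x + ψ * Complex.I) := by
    rw [← hshift fun x => f (x + ψ * Complex.I)]
    refine setIntegral_congr_fun measurableSet_Ioi fun t ht => ?_
    have ht' : ψ < t := ht
    simp only [hankelPath_of_le a h0 ht'.le, hankelDir, if_neg (not_le.2 ht'),
      if_neg (show ¬ t ≤ -ψ by linarith), mul_one]
  rw [hl, hm, hr, hankelSides]
  ring

lemma aestronglyMeasurable_hankelPath (a ψ : ℝ) {f : ℂ → ℂ} (hf : Continuous f) :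
    AEStronglyMeasurable (fun t : ℝ => f (hankelPath a ψ t) * hankelDir ψ t) :=
  (hf.comp (continuous_hankelPath a ψ)).aestronglyMeasurable.mul
    (measurable_hankelDir ψ).aestronglyMeasurable

lemma integral_hankelKernel (s a : ℝ) {ψ : ℝ} (h1 : Real.pi / 2 < ψ) (h2 : ψ ≤ Real.pi) :
    ∫ t : ℝ, hankelKernel s (hankelPath a ψ t) * hankelDir ψ t =
      2 * Real.pi * Complex.I / Complex.Gamma (1 + s) := by
  have h0 : 0 < ψ := by linarith [Real.pi_pos]
  have hψ := Real.cos_neg_of_pi_div_two_lt_of_lt h1 (by linarith [Real.pi_pos])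
  rw [integral_hankelPath h0, hankelSides_hankelKernel s a h1 h2]
  refine (integrable_norm_hankelKernel s a h0 hψ).mono'
    (aestronglyMeasurable_hankelPath a ψ (continuous_hankelKernel s))
    (Eventually.of_forall fun t => ?_)
  rw [norm_mul, norm_hankelDir, mul_one]

lemma hankelKernel_mul_exp_pow (s α : ℝ) (m : ℕ) (ζ : ℂ) :
    hankelKernel s ζ * Complex.exp (α * ζ) ^ m = hankelKernel (s - α * m) ζ := by
  rw [hankelKernel, hankelKernel, ← Complex.exp_nat_mul, ← Complex.exp_add]
  congr 1
  push_cast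
  ring

lemma wrightFn_eq_integral {α : ℝ} (hα' : α < 1) (a θ : ℝ) {ψ : ℝ}
    (h1 : Real.pi / 2 < ψ) (h2 : ψ ≤ Real.pi) :
    2 * Real.pi * Complex.I * (wrightFn α θ : ℂ) =
      ∫ t : ℝ, hankelKernel (-α) (hankelPath a ψ t) *
        Complex.exp (-θ * Complex.exp (α * hankelPath a ψ t)) * hankelDir ψ t := by
  have h0 : 0 < ψ := by linarith [Real.pi_pos]
  have hψ := Real.cos_neg_of_pi_div_two_lt_of_lt h1 (by linarith [Real.pi_pos])
  have hsum := hasSum_integral_of_dominated_convergence (μ := volume)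
    (F := fun (k : ℕ) (t : ℝ) => (-θ : ℂ) ^ k / k.factorial *
      (hankelKernel (-α - α * k) (hankelPath a ψ t) * hankelDir ψ t))
    (f := fun t : ℝ => hankelKernel (-α) (hankelPath a ψ t) *
        Complex.exp (-θ * Complex.exp (α * hankelPath a ψ t)) * hankelDir ψ t)
    (fun k t => ‖hankelKernel (-α) (hankelPath a ψ t)‖ *
      ((|θ| * Real.exp (α * (hankelPath a ψ t).re)) ^ k / k.factorial))
    (fun k => (aestronglyMeasurable_hankelPath a ψ (continuous_hankelKernel _)).const_mul _)
    (fun k => Eventually.of_forall fun t => ?_)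
    (Eventually.of_forall fun t => (Real.summable_pow_div_factorial _).mul_left _)
    ?_ (Eventually.of_forall fun t => ?_)
  · rw [← hsum.tsum_eq, wrightFn, Complex.ofReal_tsum, ← tsum_mul_left]
    refine tsum_congr fun k => ?_
    rw [integral_const_mul, integral_hankelKernel _ a h1 h2]
    push_cast
    rw [← Complex.Gamma_ofReal]
    push_cast
    rw [show (-α * k + 1 - α : ℂ) = 1 + (-α - α * k) by ring]
    ring
  · rw [norm_mul, norm_mul, norm_hankelDir, ← hankelKernel_mul_exp_pow, norm_mul, norm_div,
      norm_pow, norm_pow, norm_neg, Complex.norm_real, Complex.norm_exp, Complex.re_ofReal_mul,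
      Real.norm_eq_abs, Complex.norm_natCast]
    exact le_of_eq (by ring)
  · refine (integrable_exp_hankelPath a α |θ| hα' h0 hψ).congr (Eventually.of_forall fun t => ?_)
    simp only [tsum_mul_left]
    rw [← congrFun NormedSpace.exp_eq_tsum_div, ← Real.exp_eq_exp_ℝ, norm_hankelKernel, ← Real.exp_add]
    congr 1
    ring
  · have := ((NormedSpace.expSeries_div_hasSum_exp
      (-θ * Complex.exp (α * hankelPath a ψ t))).mul_left
      (hankelKernel (-α) (hankelPath a ψ t))).mul_right (hankelDir ψ t)
    rw [← Complex.exp_eq_exp_ℂ] at this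
    refine this.congr_fun ?_
    intro k
    rw [← hankelKernel_mul_exp_pow]
    ring

lemma integrableOn_pow_mul_exp (n : ℕ) {w : ℂ} (hw : 0 < w.re) :
    IntegrableOn (fun θ : ℝ => (θ : ℂ) ^ n * Complex.exp (-w * θ)) (Ioi 0) := by
  have hc : Continuous fun θ : ℝ => (θ : ℂ) ^ n * Complex.exp (-w * θ) := by fun_prop
  have := integrableOn_rpow_mul_exp_neg_mul_rpow (s := n) (p := 1) (b := w.re)
    (by linarith [n.cast_nonneg (α := ℝ)]) one_pos hw
  refine Integrable.mono' this hc.aestronglyMeasurable ?_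
  filter_upwards [ae_restrict_mem measurableSet_Ioi] with θ hθ
  have hθ' : (0 : ℝ) < θ := hθ
  simp [Complex.norm_exp, abs_of_pos hθ']

lemma integral_pow_mul_exp (n : ℕ) {w : ℂ} (hw : 0 < w.re) :
    ∫ θ : ℝ in Ioi 0, (θ : ℂ) ^ n * Complex.exp (-w * θ) = n.factorial / w ^ (n + 1) := by
  have hw0 : w ≠ 0 := by rintro rfl; simp at hw
  induction n with
  | zero =>
    have := integral_exp_mul_complex_Ioi (a := -w) (by simpa using hw) 0
    simpa using this
  | succ n ih =>
    have hd : ∀ θ : ℝ, HasDerivAt (fun θ : ℝ => (θ : ℂ) ^ (n + 1) * Complex.exp (-w * θ))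
        ((n + 1) * ((θ : ℂ) ^ n * Complex.exp (-w * θ)) -
          w * ((θ : ℂ) ^ (n + 1) * Complex.exp (-w * θ))) θ := fun θ => by
      have h := ((hasDerivAt_pow (n + 1) (θ : ℂ)).mul
        ((hasDerivAt_id (θ : ℂ)).const_mul (-w)).cexp).comp_ofReal
      convert! h using 1
      simp
      ring
    have i1 := (integrableOn_pow_mul_exp n hw).const_mul ((n : ℂ) + 1)
    have i2 := (integrableOn_pow_mul_exp (n + 1) hw).const_mul w
    have ht := tendsto_zero_of_hasDerivAt_of_integrableOn_Ioi (a := 0) (fun x _ => hd x)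
      (i1.sub i2) (integrableOn_pow_mul_exp (n + 1) hw)
    have h := integral_Ioi_of_hasDerivAt_of_tendsto' (a := 0) (fun x _ => hd x) (i1.sub i2) ht
    rw [integral_sub i1 i2, integral_const_mul, integral_const_mul, ih] at h
    simp only [Complex.ofReal_zero, ne_eq, Nat.add_eq_zero_iff, one_ne_zero, and_false,
      not_false_eq_true, zero_pow, zero_mul, sub_zero] at h
    rw [← mul_right_inj' hw0, ← sub_eq_zero.1 h, Nat.factorial_succ]
    push_cast
    field_simp
    ring

lemma le_re_exp_mul_hankelPath {α ψ : ℝ} (hα : 0 < α) (h0 : 0 < ψ) (h3 : α * ψ < Real.pi / 2)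
    (a t : ℝ) :
    Real.exp (α * a) * Real.cos (α * ψ) ≤ (Complex.exp (α * hankelPath a ψ t)).re := by
  rw [Complex.exp_re, Complex.re_ofReal_mul, Complex.im_ofReal_mul]
  have hcos : Real.cos (α * ψ) ≤ Real.cos (α * (hankelPath a ψ t).im) := by
    rw [← Real.cos_abs (α * (hankelPath a ψ t).im), abs_mul, abs_of_pos hα]
    exact Real.cos_le_cos_of_nonneg_of_le_pi (by positivity) (by linarith [Real.pi_pos])
      (mul_le_mul_of_nonneg_left (abs_hankelPath_im_le a t h0) hα.le)
  have h : 0 ≤ Real.cos (α * ψ) :=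
    Real.cos_nonneg_of_neg_pi_div_two_le_of_le (by linarith [Real.pi_pos, mul_pos hα h0]) h3.le
  exact mul_le_mul (Real.exp_le_exp.2 (mul_le_mul_of_nonneg_left (le_hankelPath_re a ψ t) hα.le))
    hcos h (Real.exp_pos _).le

lemma integral_pow_mul_wrightFn {α : ℝ} (hα : 0 < α) (hα' : α < 1) (n : ℕ) (z : ℂ) {a ψ : ℝ}
    (h1 : Real.pi / 2 < ψ) (h2 : ψ ≤ Real.pi) (h3 : α * ψ < Real.pi / 2)
    (ha : ‖z‖ + 1 ≤ Real.exp (α * a) * Real.cos (α * ψ)) :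
    2 * Real.pi * Complex.I *
        ∫ θ : ℝ in Ioi 0, (θ : ℂ) ^ n * (wrightFn α θ : ℂ) * Complex.exp (-z * θ) =
      ∫ t : ℝ, n.factorial / (Complex.exp (α * hankelPath a ψ t) + z) ^ (n + 1) *
        (hankelKernel (-α) (hankelPath a ψ t) * hankelDir ψ t) := by
  have h0 : 0 < ψ := by linarith [Real.pi_pos]
  have hψ := Real.cos_neg_of_pi_div_two_lt_of_lt h1 (by linarith [Real.pi_pos])
  have hre : ∀ t : ℝ, 1 ≤ (Complex.exp (α * hankelPath a ψ t) + z).re := fun t => by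
    have := le_re_exp_mul_hankelPath hα h0 h3 a t
    rw [Complex.add_re]
    linarith [neg_le_of_abs_le (Complex.abs_re_le_norm z)]
  have hcp := continuous_hankelPath a ψ
  have hck := (continuous_hankelKernel (-α)).comp hcp
  simp only [Function.comp_def] at hck
  have hint : Integrable (Function.uncurry fun (θ t : ℝ) =>
      ((θ : ℂ) ^ n * Complex.exp (-(Complex.exp (α * hankelPath a ψ t) + z) * θ)) *
      (hankelKernel (-α) (hankelPath a ψ t) * hankelDir ψ t))
      ((volume.restrict (Ioi 0)).prod volume) := by
    have hb := (integrableOn_pow_mul_exp n (w := 1) (by simp)).norm.mul_prod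
      (integrable_norm_hankelKernel (-α) a h0 hψ)
    refine hb.mono' ?_ ?_
    · refine AEStronglyMeasurable.mul (Continuous.aestronglyMeasurable (by fun_prop))
        (AEStronglyMeasurable.mul (hck.comp continuous_snd).aestronglyMeasurable ?_)
      exact ((measurable_hankelDir ψ).comp measurable_snd).aestronglyMeasurable
    · filter_upwards [Measure.quasiMeasurePreserving_fst.ae
        (ae_restrict_mem measurableSet_Ioi)] with p hp
      have hp' : 0 < p.1 := hp
      simp only [Function.uncurry, norm_mul, norm_hankelDir, mul_one]
      gcongr
      simp only [Complex.norm_exp, Complex.re_mul_ofReal, Complex.neg_re, Complex.one_re]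
      refine Real.exp_le_exp.2 (mul_le_mul_of_nonneg_right ?_ hp'.le)
      exact neg_le_neg (hre p.2)
  have hswap := integral_integral_swap hint
  simp only [integral_mul_const] at hswap
  rw [← integral_const_mul]
  refine Eq.trans ?_ (hswap.trans (integral_congr_ae (Eventually.of_forall fun t => ?_)))
  · refine integral_congr_ae (Eventually.of_forall fun θ => ?_)
    simp only
    rw [show 2 * Real.pi * Complex.I *
        ((θ : ℂ) ^ n * (wrightFn α θ : ℂ) * Complex.exp (-z * θ)) =
      (θ : ℂ) ^ n * Complex.exp (-z * θ) * (2 * Real.pi * Complex.I * (wrightFn α θ : ℂ)) by ring,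
      wrightFn_eq_integral hα' a θ h1 h2, ← integral_const_mul]
    refine integral_congr_ae (Eventually.of_forall fun t => ?_)
    simp only
    rw [show -(Complex.exp (α * hankelPath a ψ t) + z) * θ =
      -z * θ + -θ * Complex.exp (α * hankelPath a ψ t) by ring, Complex.exp_add]
    ring
  · simp only
    rw [integral_pow_mul_exp n (by linarith [hre t])]

/-- The Laplace transform of `θ ^ n * wrightFn α θ` as a power series. -/
lemma hasSum_integral_pow_mul_wrightFn {α : ℝ} (hα : 0 < α) (hα' : α < 1) (n : ℕ) (z : ℂ) :
    HasSum (fun k : ℕ => n.factorial * (k + n).choose n * (-z) ^ k /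
        Complex.Gamma (1 + α * (k + n)))
      (∫ θ : ℝ in Ioi 0, (θ : ℂ) ^ n * (wrightFn α θ : ℂ) * Complex.exp (-z * θ)) := by
  obtain ⟨ψ, h1, h2, h3⟩ : ∃ ψ, Real.pi / 2 < ψ ∧ ψ ≤ Real.pi ∧ α * ψ < Real.pi / 2 := by
    have hpi := Real.pi_pos
    refine ⟨Real.pi / (1 + α), ?_, ?_, ?_⟩
    · exact div_lt_div_of_pos_left hpi (by linarith) (by linarith)
    · exact div_le_self hpi.le (by linarith)
    · rw [← mul_div_assoc, div_lt_div_iff₀ (by linarith) two_pos]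
      nlinarith
  have h0 : 0 < ψ := by linarith [Real.pi_pos]
  have hψ := Real.cos_neg_of_pi_div_two_lt_of_lt h1 (by linarith [Real.pi_pos])
  have hcos : 0 < Real.cos (α * ψ) :=
    Real.cos_pos_of_mem_Ioo ⟨by linarith [Real.pi_pos, mul_pos hα h0], h3⟩
  obtain ⟨a, ha⟩ : ∃ a, ‖z‖ + 1 ≤ Real.exp (α * a) * Real.cos (α * ψ) := by
    refine ⟨Real.log ((‖z‖ + 1) / Real.cos (α * ψ)) / α, ?_⟩
    rw [mul_div_cancel₀ _ hα.ne', Real.exp_log (by positivity), div_mul_cancel₀ _ hcos.ne']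
  have hnorm : ∀ t, ‖z‖ + 1 ≤ ‖Complex.exp (α * hankelPath a ψ t)‖ := fun t =>
    ha.trans ((le_re_exp_mul_hankelPath hα h0 h3 a t).trans (Complex.re_le_norm _))
  have hz : 0 ≤ ‖z‖ := norm_nonneg z
  have hr : ‖‖z‖ / (‖z‖ + 1)‖ < 1 := by
    rw [Real.norm_eq_abs, abs_of_nonneg (by positivity), div_lt_one (by positivity)]
    linarith
  have hgeom := (hasSum_choose_mul_geometric_of_norm_lt_one n hr).mul_left (n.factorial : ℝ)
  have hker : ∀ (k : ℕ) t, hankelKernel (α * (k + n)) (hankelPath a ψ t) *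
      Complex.exp (α * hankelPath a ψ t) ^ (k + n + 1) =
        hankelKernel (-α) (hankelPath a ψ t) := fun k t => by
    rw [hankelKernel_mul_exp_pow]
    congr 1
    push_cast
    ring
  have hsum := hasSum_integral_of_dominated_convergence (μ := volume)
    (F := fun (k : ℕ) (t : ℝ) => n.factorial * (k + n).choose n * (-z) ^ k *
      (hankelKernel (α * (k + n)) (hankelPath a ψ t) * hankelDir ψ t))
    (f := fun t : ℝ => n.factorial / (Complex.exp (α * hankelPath a ψ t) + z) ^ (n + 1) *
        (hankelKernel (-α) (hankelPath a ψ t) * hankelDir ψ t))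
    (fun k t => n.factorial * ((k + n).choose n * (‖z‖ / (‖z‖ + 1)) ^ k) *
      ‖hankelKernel (-α) (hankelPath a ψ t)‖)
    (fun k => (aestronglyMeasurable_hankelPath a ψ (continuous_hankelKernel _)).const_mul _)
    (fun k => Eventually.of_forall fun t => ?_)
    (Eventually.of_forall fun t => hgeom.summable.mul_right _)
    ?_ (Eventually.of_forall fun t => ?_)
  · rw [← integral_pow_mul_wrightFn hα hα' n z h1 h2 h3 ha] at hsum
    have hne : (2 * Real.pi * Complex.I : ℂ) ≠ 0 := Complex.two_pi_I_ne_zero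
    rw [← hasSum_mul_left_iff hne]
    refine hsum.congr_fun fun k => ?_
    rw [integral_const_mul, integral_hankelKernel _ a h1 h2]
    push_cast
    ring
  · rw [← hker k t]
    simp only [norm_mul, norm_pow, norm_hankelDir, norm_neg, mul_one, Complex.norm_natCast]
    rw [div_pow]
    have hpow : (‖z‖ + 1) ^ k ≤ ‖Complex.exp (α * hankelPath a ψ t)‖ ^ (k + n + 1) :=
      (pow_le_pow_right₀ (by linarith) (by omega)).trans
        (pow_le_pow_left₀ (by positivity) (hnorm t) (k + n + 1))
    have hone : 1 ≤ ‖Complex.exp (α * hankelPath a ψ t)‖ ^ (k + n + 1) / (‖z‖ + 1) ^ k :=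
      (one_le_div (by positivity)).2 hpow
    have := mul_le_mul_of_nonneg_left hone (show 0 ≤ (n.factorial : ℝ) * (k + n).choose n *
      ‖z‖ ^ k * ‖hankelKernel (α * (k + n)) (hankelPath a ψ t)‖ by positivity)
    calc _ = (n.factorial : ℝ) * (k + n).choose n *
          ‖z‖ ^ k * ‖hankelKernel (α * (k + n)) (hankelPath a ψ t)‖ * 1 := by ring
      _ ≤ _ := this
      _ = _ := by ring
  · simp only [tsum_mul_right]
    exact (integrable_norm_hankelKernel (-α) a h0 hψ).const_mul _
  · have hu : Complex.exp (α * hankelPath a ψ t) ≠ 0 := Complex.exp_ne_zero _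
    have hr' : ‖-z / Complex.exp (α * hankelPath a ψ t)‖ < 1 := by
      rw [norm_div, norm_neg, div_lt_one (norm_pos_iff.2 hu)]
      linarith [hnorm t]
    have h := ((hasSum_choose_mul_geometric_of_norm_lt_one n hr').mul_left
      ((n.factorial : ℂ) / Complex.exp (α * hankelPath a ψ t) ^ (n + 1))).mul_right
      (hankelKernel (-α) (hankelPath a ψ t) * hankelDir ψ t)
    have hval : (n.factorial : ℂ) / Complex.exp (α * hankelPath a ψ t) ^ (n + 1) *
        (1 / (1 - -z / Complex.exp (α * hankelPath a ψ t)) ^ (n + 1)) =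
        n.factorial / (Complex.exp (α * hankelPath a ψ t) + z) ^ (n + 1) := by
      rw [div_mul_div_comm, mul_one, ← mul_pow, mul_sub, mul_one, mul_div_cancel₀ _ hu,
        sub_neg_eq_add]
    rw [hval] at h
    refine h.congr_fun fun k => ?_
    rw [← hker k t, div_pow, show k + n + 1 = (n + 1) + k by ring, pow_add]
    field_simp
    ring

/-- Laplace transform identities for the Wright function:
`∫_0^∞ φ_α(θ) e^{−zθ} dθ = E_{α,1}(−z)` and
`α ∫_0^∞ θ φ_α(θ) e^{−zθ} dθ = E_{α,α}(−z)`. -/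
theorem wrightFn_laplace (α : ℝ) (hα : 0 < α) (hα' : α < 1) (z : ℂ) :
    ((∫ θ in Set.Ioi (0:ℝ), (wrightFn α θ : ℂ) * Complex.exp (-z * (θ : ℂ))) =
        mittagLeffler α 1 (-z)) ∧
    ((α : ℂ) *
        ∫ θ in Set.Ioi (0:ℝ), (θ : ℂ) * (wrightFn α θ : ℂ) * Complex.exp (-z * (θ : ℂ)) =
      mittagLeffler α α (-z)) := by
  constructor
  · have h := hasSum_integral_pow_mul_wrightFn hα hα' 0 z
    simp only [pow_zero, one_mul] at h
    rw [← h.tsum_eq, mittagLeffler]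
    refine tsum_congr fun k => ?_
    simp [add_comm]
  · have h := (hasSum_integral_pow_mul_wrightFn hα hα' 1 z).mul_left (α : ℂ)
    simp only [pow_one] at h
    rw [← h.tsum_eq, mittagLeffler]
    refine tsum_congr fun k => ?_
    have hx : 0 < α * (k + 1) := by positivity
    have hxc : ((α : ℂ) * (k + 1)) ≠ 0 := by exact_mod_cast hx.ne'
    have hG := Complex.Gamma_add_one _ hxc
    have hG0 : Complex.Gamma ((α : ℂ) * (k + 1)) ≠ 0 :=
      Complex.Gamma_ne_zero_of_re_pos (by exact_mod_cast hx)
    have hk : (k + 1 : ℂ) ≠ 0 := right_ne_zero_of_mul hxc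
    have hαc : (α : ℂ) ≠ 0 := left_ne_zero_of_mul hxc
    rw [show ((α * k + α : ℝ) : ℂ) = (α : ℂ) * (k + 1) by push_cast; ring, Nat.cast_one,
      add_comm (1 : ℂ), hG]
    simp
    field_simp

end
end
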